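/- Let $d,m\ge 1$ be integers, $M=\{1,\dots,m\}$, and write $B(x,r)$ for the open ball in $\mathbb R^d$. A domain is a nonempty connected open subset of $\mathbb R^d$. **Coefficients.** For each $i\in M$ let $b(\cdot,i):\mathbb R^d\to\mathbb R^d$ and $\sigma(\cdot,i):\mathbb R^d\to\mathbb R^{d\times d}$ be continuous with $\sum_{k,l}|\sigma_{kl}(x,i)|+\sum_k|b_k(x,i)|\le c(1+|x|)$ for some $c>0$, and let $a=\sigma\sigma^{T}$ be locally uniformly elliptic: for every bounded domain $B$ there is $\kappa_0\in(0,1]$ with $\kappa_0|\xi|^2\le\xi^{T}a(x,i)\xi\le\kappa_0^{-1}|\xi|^2$ for all $\xi\in\mathbb R^d$, $x\in B$, $i\in M$. Let $q_{ij}:\mathbb R^d\to\mathbb R$ $(i,j\in M)$ be bounded Borel functions with $q_{ij}\ge0$ for $i\ne j$ and $\sum_{j}q_{ij}=0$. For $i\in M$ let $\pi_i(x,dz)=\tilde\pi_i(x,z)\,dz$ with $\tilde\pi_i\ge0$ jointly Borel measurable and $\int(1\wedge|z|^2)\,\pi_i(x,dz)<\infty$, such that $\sup_{x,i}\pi_i(x,B(0,1)^c)<\infty$;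 $\int_{B(0,1)}|z|^2\pi_i(x,dz)\le c(1+|x|^2)$ for all $x,i$ and some $c>0$; for every $n\ge1$ there is a $\sigma$-finite measure $\Pi_n$ with $\int(1\wedge|z|^2)\,\Pi_n(dz)<\infty$ and $\pi_i(x,\cdot)\le\Pi_n$ for all $x\in B(0,n)$, $i\in M$; and there are $\kappa_2,\beta>0$ such that for every $r\in(0,1)$ there is $\alpha_r$ with $1<\alpha_r<\kappa_2r^{-\beta}$ and $\tilde\pi_i(x,z-x)\le\alpha_r\tilde\pi_i(y,z-y)$ for all $x_0\in\mathbb R^d$, $x,y\in B(x_0,r/2)$, $z\in B(x_0,r)^c$, $i\in M$. **Generator.** For $f:\mathbb R^d\times M\to\mathbb R$ with $f(\cdot,i)\in C^2(\mathbb R^d)$ for each $i$ put $$Gf(x,i)=\tfrac12\sum_{k,l}a_{kl}(x,i)\frac{\partial^2f(x,i)}{\partial x_k\partial x_l}+\sum_kb_k(x,i)\frac{\partial f(x,i)}{\partial x_k}+\int_{\mathbb R^d}\big[f(x+z,i)-f(x,i)-\nabla f(x,i)\cdot z\,1_{|z|<1}\big]\pi_i(x,dz)+\sum_{j\in M}q_{ij}(x)f(x,j).$$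 $G$ is strictly irreducible on $B\subset\mathbb R^d$ if $\inf_{x\in B}q_{ij}(x)>0$ for all $i\ne j$ in $M$. **Process.** Let $(X(t),\Lambda(t))_{t\ge0}$ be the coordinate process on the space of càdlàg paths $[0,\infty)\to\mathbb R^d\times M$, with the right continuous filtration that it generates, and let $(P_{x,i})$ be a family of laws on this space, measurable in $(x,i)$, under which it is a strong Markov process and such that, for each $(x,i)$, $P_{x,i}$ is the unique solution of the martingale problem for $(G,C_b^2(\mathbb R^d))$ started at $(x,i)$; that is, the unique probability measure with $P_{x,i}(X(0)=x,\Lambda(0)=i)=1$ under which $$f(X(t),\Lambda(t))-f(x,i)-\int_0^tGf(X(s),\Lambda(s))\,ds$$ is a martingale for every $f$ such that each $f(\cdot,j)$, $j\in M$, is $C^2$ and bounded together with its partial derivatives of order one and two. **Recurrence.** For $U\subset\mathbb R^d\times M$ let $\sigma_U=\inf\{t\ge0:(X(t),\Lambda(t))\in U\}$. The process is positive recurrent with respect to $U$ if $P_{x,i}(\sigma_U<\infty)=1$ and $E_{x,i}[\sigma_U]<\infty$ for every $(x,i)\in U^c$. **Theorem.** Suppose that $G$ is strictly irreducible on every bounded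 domain of $\mathbb R^d$. Let $D,E\subset\mathbb R^d$ be bounded domains, let $l\in M$, and suppose that condition (C1) holds with respect to $D\times M$: there are nonnegative functions $V(\cdot,i)\in C^2(\mathbb R^d)$, $i\in M$, such that for all $(x,i)\in D^c\times M$ the integral in $GV(x,i)$ is finite and $GV(x,i)\le-1$. Then $(X(t),\Lambda(t))$ is positive recurrent with respect to $D\times M$ if and only if it is positive recurrent with respect to $E\times M$; and it is positive recurrent with respect to $E\times M$ if and only if it is positive recurrent with respect to $E\times\{l\}$. -/

import Mathlib

open MeasureTheory ProbabilityTheory Set Filter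
open scoped NNReal ENNReal Topology

namespace SJD

noncomputable section

/-- Euclidean space `ℝ^d`. -/
abbrev Rd (d : ℕ) : Type := EuclideanSpace ℝ (Fin d)

/-- A bounded domain of `ℝ^d`: a nonempty connected open bounded set. -/
def BddDomain {d : ℕ} (D : Set (Rd d)) : Prop :=
  IsOpen D ∧ IsConnected D ∧ Bornology.IsBounded D

/-! ### The coefficients and the generator -/

/-- The coefficients of a regime-switching jump diffusion on `ℝ^d × M`, `M = Fin m`:
the drift `b(x,i)`, the matrix `σ(x,i)`, the switching rates `q_{ij}(x)` and the jump density
`π̃_i(x,z)`. -/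
structure Coeffs (d m : ℕ) where
  /-- drift `b(x,i)` -/
  b : Rd d → Fin m → Rd d
  /-- diffusion matrix `σ(x,i)` -/
  sig : Rd d → Fin m → Matrix (Fin d) (Fin d) ℝ
  /-- switching rates `q_{ij}(x)`, written `q x i j` -/
  q : Rd d → Fin m → Fin m → ℝ
  /-- jump density `π̃_i(x,z)`, written `pit x i z` -/
  pit : Rd d → Fin m → Rd d → ℝ

namespace Coeffs

variable {d m : ℕ}

/-- `a = σ σᵀ`. -/
def a (c : Coeffs d m) (x : Rd d) (i : Fin m) : Matrix (Fin d) (Fin d) ℝ :=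
  c.sig x i * (c.sig x i).transpose

/-- The jump measure `π_i(x,dz) = π̃_i(x,z) dz`. -/
def jumpMeasure (c : Coeffs d m) (x : Rd d) (i : Fin m) : Measure (Rd d) :=
  volume.withDensity fun z => ENNReal.ofReal (c.pit x i z)

/-- The integrand `z ↦ f(x+z,i) − f(x,i) − ∇f(x,i)·z 1_{|z|<1}` of the jump part. -/
def jumpIntegrand (f : Rd d → Fin m → ℝ) (x : Rd d) (i : Fin m) (z : Rd d) : ℝ :=
  f (x + z) i - f x i - if ‖z‖ < 1 then fderiv ℝ (fun y => f y i) x z else 0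

/-- The generator `G`. The jump part is a Bochner integral, so the value is the intended one
when `jumpIntegrand f x i` is integrable for `π_i(x,·)`; for `f` in `C_b²` this holds under the
standing assumptions, and for the unbounded functions of condition (C1) it is required there. -/
def gen (c : Coeffs d m) (f : Rd d → Fin m → ℝ) (x : Rd d) (i : Fin m) : ℝ :=
  (1 / 2) * ∑ k, ∑ l, c.a x i k l *
      iteratedFDeriv ℝ 2 (fun y => f y i) x
        ![EuclideanSpace.single k (1 : ℝ), EuclideanSpace.single l (1 : ℝ)]
    + ∑ k, c.b x i k * fderiv ℝ (fun y => f y i) x (EuclideanSpace.single k (1 : ℝ))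
    + ∫ z, jumpIntegrand f x i z ∂(c.jumpMeasure x i)
    + ∑ j, c.q x i j * f x j

/-- The standing assumptions on the coefficients. -/
structure Standing (c : Coeffs d m) : Prop where
  sig_cont : ∀ i, Continuous fun x => c.sig x i
  b_cont : ∀ i, Continuous fun x => c.b x i
  growth : ∃ C > (0 : ℝ), ∀ x i,
    (∑ k, ∑ l, |c.sig x i k l|) + ∑ k, |c.b x i k| ≤ C * (1 + ‖x‖)
  q_meas : ∀ i j, Measurable fun x => c.q x i j
  q_bdd : ∀ i j, ∃ C : ℝ, ∀ x, |c.q x i j| ≤ C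
  q_nonneg : ∀ x i j, i ≠ j → 0 ≤ c.q x i j
  q_rowsum : ∀ x i, ∑ j, c.q x i j = 0
  ellipticity : ∀ D : Set (Rd d), BddDomain D →
    ∃ κ₀ ∈ Set.Ioc (0 : ℝ) 1, ∀ x ∈ D, ∀ (i : Fin m) (ξ : Rd d),
      κ₀ * ‖ξ‖ ^ 2 ≤ ∑ k, ∑ l, ξ k * c.a x i k l * ξ l ∧
      ∑ k, ∑ l, ξ k * c.a x i k l * ξ l ≤ κ₀⁻¹ * ‖ξ‖ ^ 2
  pit_nonneg : ∀ x i z, 0 ≤ c.pit x i z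
  pit_meas : ∀ i, Measurable fun p : Rd d × Rd d => c.pit p.1 i p.2
  levy_integrable : ∀ x i,
    ∫⁻ z, ENNReal.ofReal (min 1 (‖z‖ ^ 2)) ∂(c.jumpMeasure x i) < ⊤
  bigjump_bdd : ∃ C : ℝ≥0∞, C < ⊤ ∧ ∀ x i,
    c.jumpMeasure x i (Metric.ball (0 : Rd d) 1)ᶜ ≤ C
  smalljump : ∃ C > (0 : ℝ), ∀ x i,
    ∫⁻ z in Metric.ball (0 : Rd d) 1, ENNReal.ofReal (‖z‖ ^ 2) ∂(c.jumpMeasure x i)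
      ≤ ENNReal.ofReal (C * (1 + ‖x‖ ^ 2))
  domination : ∀ n : ℕ, 1 ≤ n → ∃ Pin : Measure (Rd d), SigmaFinite Pin ∧
    ∫⁻ z, ENNReal.ofReal (min 1 (‖z‖ ^ 2)) ∂Pin < ⊤ ∧
    ∀ x ∈ Metric.ball (0 : Rd d) n, ∀ i, c.jumpMeasure x i ≤ Pin
  comparability : ∃ κ₂ > (0 : ℝ), ∃ β > (0 : ℝ), ∀ r ∈ Set.Ioo (0 : ℝ) 1, ∃ αr : ℝ,
    1 < αr ∧ αr < κ₂ * r ^ (-β) ∧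
    ∀ (x₀ x y z : Rd d) (i : Fin m), x ∈ Metric.ball x₀ (r / 2) → y ∈ Metric.ball x₀ (r / 2) →
      z ∉ Metric.ball x₀ r → c.pit x i (z - x) ≤ αr * c.pit y i (z - y)

/-- `G` is strictly irreducible on `D`. -/
def StrictIrred (c : Coeffs d m) (D : Set (Rd d)) : Prop :=
  ∀ i j : Fin m, i ≠ j → ∃ q0 > (0 : ℝ), ∀ x ∈ D, q0 ≤ c.q x i j

/-- Condition (C1) with respect to `D × M`. For `V ≥ 0` of class `C²` the jump part of `GV(x,i)`
has a value in `(-∞, ∞]`, which is finite exactly when the integrand is integrable, so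
`GV(x,i) ≤ -1` consists of the integrability and of the inequality. -/
def C1 (c : Coeffs d m) (D : Set (Rd d)) : Prop :=
  ∃ V : Rd d → Fin m → ℝ, (∀ i, ContDiff ℝ 2 fun y => V y i) ∧ (∀ x i, 0 ≤ V x i) ∧
    ∀ x ∉ D, ∀ i, Integrable (jumpIntegrand V x i) (c.jumpMeasure x i) ∧ c.gen V x i ≤ -1

end Coeffs

/-- `f(·,i) ∈ C_b²(ℝ^d)` for every `i`: twice continuously differentiable, and bounded together
with the derivatives of order one and two. -/
def IsCb2 {d m : ℕ} (f : Rd d → Fin m → ℝ) : Prop :=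
  (∀ i, ContDiff ℝ 2 fun y => f y i) ∧
    ∀ i, ∃ C : ℝ, ∀ x, |f x i| ≤ C ∧ ‖fderiv ℝ (fun y => f y i) x‖ ≤ C ∧
      ‖iteratedFDeriv ℝ 2 (fun y => f y i) x‖ ≤ C

/-! ### The path space -/

/-- Right continuous with left limits. -/
def IsCadlag {S : Type*} [TopologicalSpace S] (w : ℝ≥0 → S) : Prop :=
  (∀ t, ContinuousWithinAt w (Set.Ici t) t) ∧ ∀ t, 0 < t → ∃ L, Tendsto w (𝓝[<] t) (𝓝 L)

/-- The path space `D([0,∞), ℝ^d × M)`. -/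
def CadlagPath (d m : ℕ) : Type := {w : ℝ≥0 → Rd d × Fin m // IsCadlag w}

variable {d m : ℕ}

/-- The coordinate process `(X(t), Λ(t))(w) = w(t)`. -/
def Z (t : ℝ≥0) (w : CadlagPath d m) : Rd d × Fin m := w.1 t

/-- The σ-algebra generated by the coordinates, which is the Borel σ-algebra of the Skorokhod
topology. -/
instance instMeasurableSpaceCadlagPath : MeasurableSpace (CadlagPath d m) :=
  ⨆ t : ℝ≥0, MeasurableSpace.comap (Z t) inferInstance

theorem measurable_Z (t : ℝ≥0) : Measurable (Z t : CadlagPath d m → Rd d × Fin m) :=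
  Measurable.of_comap_le (le_iSup (fun t : ℝ≥0 =>
    MeasurableSpace.comap (Z t : CadlagPath d m → Rd d × Fin m) inferInstance) t)

/-- The right continuous filtration `(ℱ_{t+})` generated by the coordinate process. -/
def filt (d m : ℕ) : Filtration ℝ≥0 (instMeasurableSpaceCadlagPath (d := d) (m := m)) :=
  (Filtration.natural Z fun t => (measurable_Z t).stronglyMeasurable).rightCont

theorem IsCadlag.shift {S : Type*} [TopologicalSpace S] {w : ℝ≥0 → S} (hw : IsCadlag w)
    (s : ℝ≥0) : IsCadlag fun t => w (s + t) := by
  have hc : ∀ t : ℝ≥0, Tendsto (fun u : ℝ≥0 => s + u) (𝓝 t) (𝓝 (s + t)) := fun t =>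
    (continuous_const.add continuous_id).tendsto t
  refine ⟨fun t => ?_, fun t ht => ?_⟩
  · refine (hw.1 (s + t)).tendsto.comp (tendsto_nhdsWithin_iff.2
      ⟨(hc t).mono_left nhdsWithin_le_nhds, ?_⟩)
    filter_upwards [self_mem_nhdsWithin] with u hu
    exact add_le_add_right (show t ≤ u from hu) s
  · obtain ⟨L, hL⟩ := hw.2 (s + t) (lt_of_lt_of_le ht le_add_self)
    refine ⟨L, hL.comp (tendsto_nhdsWithin_iff.2
      ⟨(hc t).mono_left nhdsWithin_le_nhds, ?_⟩)⟩
    filter_upwards [self_mem_nhdsWithin] with u hu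
    exact add_lt_add_right (show u < t from hu) s

/-- The shift `(θ_s w)(t) = w(s + t)`. -/
def shift (s : ℝ≥0) (w : CadlagPath d m) : CadlagPath d m :=
  ⟨fun t => w.1 (s + t), w.2.shift s⟩

/-! ### The process -/

/-- The probability measure `ν` on the path space solves the martingale problem for
`(G, C_b²(ℝ^d))` started at `(x,i)`. -/
structure SolvesMP (c : Coeffs d m) (x : Rd d) (i : Fin m)
    (ν : Measure (CadlagPath d m)) : Prop where
  prob : IsProbabilityMeasure ν
  init : ν {w | Z 0 w = (x, i)} = 1
  martingale : ∀ f : Rd d → Fin m → ℝ, IsCb2 f →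
    Martingale
      (fun (t : ℝ≥0) (w : CadlagPath d m) => f (Z t w).1 (Z t w).2 - f x i -
        ∫ u in Set.Ioc (0 : ℝ) (t : ℝ), c.gen f (Z u.toNNReal w).1 (Z u.toNNReal w).2)
      (filt d m) ν

/-- The strong Markov property of the family of laws `(P_{x,i})`: for every stopping time `τ`,
every `A ∈ ℱ_τ` and every measurable set `B` of paths,
`P_{x,i}(A, τ < ∞, θ_τ ∈ B) = E_{x,i}[P_{(X(τ),Λ(τ))}(B); A, τ < ∞]`. -/
def StrongMarkov (P : Kernel (Rd d × Fin m) (CadlagPath d m)) : Prop :=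
  ∀ (p : Rd d × Fin m) (τ : CadlagPath d m → WithTop ℝ≥0) (hτ : IsStoppingTime (filt d m) τ)
    (A B : Set (CadlagPath d m)), MeasurableSet[hτ.measurableSpace] A → MeasurableSet B →
    P p {w | w ∈ A ∧ τ w < ⊤ ∧ shift ((τ w).untopD 0) w ∈ B} =
      ∫⁻ w in {w | w ∈ A ∧ τ w < ⊤}, P (Z ((τ w).untopD 0) w) B ∂(P p)

/-- The coordinate process under the laws `(P_{x,i})` is the switching jump diffusion with
coefficients `c`: a strong Markov process such that `P_{x,i}` is, for every `(x,i)`, the unique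
solution of the martingale problem for `(G, C_b²(ℝ^d))` started at `(x,i)`. -/
structure IsProcess (c : Coeffs d m) (P : Kernel (Rd d × Fin m) (CadlagPath d m)) : Prop where
  solves : ∀ x i, SolvesMP c x i (P (x, i))
  unique : ∀ x i (ν : Measure (CadlagPath d m)), SolvesMP c x i ν → ν = P (x, i)
  strongMarkov : StrongMarkov P

/-! ### Recurrence -/

/-- `σ_U = inf {t ≥ 0 : (X(t),Λ(t)) ∈ U}`, equal to `∞` if `U` is never hit. -/
def hit (U : Set (Rd d × Fin m)) (w : CadlagPath d m) : ℝ≥0∞ :=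
  ⨅ (t : ℝ≥0) (_ : Z t w ∈ U), (t : ℝ≥0∞)

/-- Recurrence with respect to `U`. -/
def Recurrent (P : Kernel (Rd d × Fin m) (CadlagPath d m)) (U : Set (Rd d × Fin m)) : Prop :=
  ∀ p ∉ U, P p {w | hit U w < ⊤} = 1

/-- Positive recurrence with respect to `U`. -/
def PosRecurrent (P : Kernel (Rd d × Fin m) (CadlagPath d m)) (U : Set (Rd d × Fin m)) : Prop :=
  Recurrent P U ∧ ∀ p ∉ U, ∫⁻ w, hit U w ∂(P p) < ⊤

end

end SJD

namespace SJD

noncomputable section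

variable {d m : ℕ}

/-! ### The jump part and the generator -/

/-- The model envelope of the jump integrand: quadratic for small jumps, constant for large. -/
def jumpEnvelope (a b : ℝ) (z : Rd d) : ℝ := if ‖z‖ < 1 then a * ‖z‖ ^ 2 else b

theorem measurable_jumpEnvelope (a b : ℝ) : Measurable (jumpEnvelope (d := d) a b) := by
  unfold jumpEnvelope
  exact Measurable.ite (measurableSet_lt measurable_norm measurable_const)
    (by fun_prop) measurable_const

theorem jumpEnvelope_nonneg {a b : ℝ} (ha : 0 ≤ a) (hb : 0 ≤ b) (z : Rd d) :
    0 ≤ jumpEnvelope a b z := by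
  unfold jumpEnvelope
  split_ifs <;> positivity

/-- The constant bounding the integrals of envelopes against all jump measures. -/
theorem exists_jump_constant {c : Coeffs d m} (hc : c.Standing) :
    ∃ C > (0 : ℝ), ∀ x i (a b : ℝ), 0 ≤ a → 0 ≤ b →
      Integrable (jumpEnvelope a b) (c.jumpMeasure x i) ∧
      ∫ z, jumpEnvelope a b z ∂(c.jumpMeasure x i) ≤ C * (a * (1 + ‖x‖ ^ 2) + b) := by
  obtain ⟨B, hB, hbig⟩ := hc.bigjump_bdd
  obtain ⟨S, hS, hsmall⟩ := hc.smalljump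
  refine ⟨S + B.toReal, by positivity, fun x i a b ha hb => ?_⟩
  have hball : MeasurableSet (Metric.ball (0 : Rd d) 1) := measurableSet_ball
  have hle : ∫⁻ z, ENNReal.ofReal (jumpEnvelope a b z) ∂(c.jumpMeasure x i) ≤
      ENNReal.ofReal ((S + B.toReal) * (a * (1 + ‖x‖ ^ 2) + b)) := by
    rw [← lintegral_add_compl _ hball]
    have h1 : ∫⁻ z in Metric.ball (0 : Rd d) 1, ENNReal.ofReal (jumpEnvelope a b z)
        ∂(c.jumpMeasure x i) ≤ ENNReal.ofReal (a * (S * (1 + ‖x‖ ^ 2))) := by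
      have : ∫⁻ z in Metric.ball (0 : Rd d) 1, ENNReal.ofReal (jumpEnvelope a b z)
          ∂(c.jumpMeasure x i) = ∫⁻ z in Metric.ball (0 : Rd d) 1,
            ENNReal.ofReal a * ENNReal.ofReal (‖z‖ ^ 2) ∂(c.jumpMeasure x i) := by
        refine setLIntegral_congr_fun hball fun z hz => ?_
        have hz' : ‖z‖ < 1 := by simpa using hz
        simp only [jumpEnvelope, if_pos hz', ENNReal.ofReal_mul ha]
      rw [this, lintegral_const_mul _ (by fun_prop), ENNReal.ofReal_mul ha]
      gcongr
      exact hsmall x i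
    have h2 : ∫⁻ z in (Metric.ball (0 : Rd d) 1)ᶜ, ENNReal.ofReal (jumpEnvelope a b z)
        ∂(c.jumpMeasure x i) ≤ ENNReal.ofReal (b * B.toReal) := by
      have : ∫⁻ z in (Metric.ball (0 : Rd d) 1)ᶜ, ENNReal.ofReal (jumpEnvelope a b z)
          ∂(c.jumpMeasure x i) = ∫⁻ _ in (Metric.ball (0 : Rd d) 1)ᶜ,
            ENNReal.ofReal b ∂(c.jumpMeasure x i) := by
        refine setLIntegral_congr_fun hball.compl fun z hz => ?_
        have hz' : ¬ ‖z‖ < 1 := by simpa using hz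
        simp only [jumpEnvelope, if_neg hz']
      rw [this, setLIntegral_const, ENNReal.ofReal_mul hb, ENNReal.ofReal_toReal hB.ne]
      gcongr
      exact hbig x i
    refine (add_le_add h1 h2).trans ?_
    rw [← ENNReal.ofReal_add (by positivity) (by positivity)]
    apply ENNReal.ofReal_le_ofReal
    have h0 : 0 ≤ B.toReal * (a * (1 + ‖x‖ ^ 2)) := by positivity
    have h1 : 0 ≤ S * b := by positivity
    nlinarith
  have hnn : 0 ≤ᵐ[c.jumpMeasure x i] jumpEnvelope a b :=
    Eventually.of_forall (jumpEnvelope_nonneg ha hb)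
  refine ⟨⟨(measurable_jumpEnvelope a b).aestronglyMeasurable, ?_⟩, ?_⟩
  · rw [hasFiniteIntegral_iff_ofReal hnn]
    exact hle.trans_lt ENNReal.ofReal_lt_top
  · rw [integral_eq_lintegral_of_nonneg_ae hnn (measurable_jumpEnvelope a b).aestronglyMeasurable]
    exact ENNReal.toReal_le_of_le_ofReal (by positivity) hle

/-- Second order Taylor estimate for a function of class `C²` with second derivative bounded on
a convex set. -/
theorem abs_taylor_le {F : Type*} [NormedAddCommGroup F] [NormedSpace ℝ F]
    {g : F → ℝ} (hg : ContDiff ℝ 2 g) {s : Set F} (hs : Convex ℝ s)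
    {K : ℝ} (hK : ∀ y ∈ s, ‖fderiv ℝ (fderiv ℝ g) y‖ ≤ K) {x z : F} (hx : x ∈ s)
    (hxz : x + z ∈ s) : |g (x + z) - g x - fderiv ℝ g x z| ≤ K * ‖z‖ ^ 2 := by
  have hg1 : ContDiff ℝ 1 (fderiv ℝ g) := hg.fderiv_right (by norm_num)
  have hK0 : 0 ≤ K := (norm_nonneg (fderiv ℝ (fderiv ℝ g) x)).trans (hK x hx)
  have hseg : segment ℝ x (x + z) ⊆ s := hs.segment_subset hx hxz
  have hlip : ∀ y ∈ segment ℝ x (x + z), ‖fderiv ℝ g y - fderiv ℝ g x‖ ≤ K * ‖z‖ := by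
    intro y hy
    refine (hs.norm_image_sub_le_of_norm_fderiv_le
      (fun y _ => (hg1.differentiable (by norm_num)) y) hK hx (hseg hy)).trans ?_
    gcongr
    have := norm_sub_le_of_mem_segment hy
    simpa using this
  have := Convex.norm_image_sub_le_of_norm_hasFDerivWithin_le' (𝕜 := ℝ)
    (fun y _ => ((hg.differentiable (by norm_num)) y).hasFDerivAt.hasFDerivWithinAt)
    hlip (convex_segment x (x + z)) (left_mem_segment ℝ x (x + z)) (right_mem_segment ℝ x (x + z))
  simp only [add_sub_cancel_left, Real.norm_eq_abs] at this
  linarith [this, show K * ‖z‖ * ‖z‖ = K * ‖z‖ ^ 2 by ring]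

theorem exists_norm_fderiv_fderiv_le {F : Type*} [NormedAddCommGroup F] [NormedSpace ℝ F]
    [ProperSpace F] {g : F → ℝ} (hg : ContDiff ℝ 2 g) (x : F) (R : ℝ) :
    ∃ K ≥ (0 : ℝ), ∀ y ∈ Metric.closedBall x R, ‖fderiv ℝ (fderiv ℝ g) y‖ ≤ K := by
  have hcont : Continuous (fderiv ℝ (fderiv ℝ g)) :=
    (hg.fderiv_right (m := 1) (by norm_num)).continuous_fderiv (by norm_num)
  have hnorm : Continuous fun y => ‖fderiv ℝ (fderiv ℝ g) y‖ :=
    Continuous.norm (E := F →L[ℝ] F →L[ℝ] ℝ) hcont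
  obtain ⟨K, hK⟩ := (isCompact_closedBall x R).bddAbove_image hnorm.continuousOn
  exact ⟨max K 0, le_max_right _ _, fun y hy =>
    (hK (mem_image_of_mem _ hy)).trans (le_max_left _ _)⟩

theorem measurable_jumpIntegrand {f : Rd d → Fin m → ℝ} {i : Fin m}
    (hf : ContDiff ℝ 2 fun y => f y i) (x : Rd d) : Measurable (Coeffs.jumpIntegrand f x i) := by
  unfold Coeffs.jumpIntegrand
  have h : Measurable fun y => f y i := hf.continuous.measurable
  refine ((h.comp (measurable_const.add measurable_id)).sub_const _).sub ?_
  exact Measurable.ite (measurableSet_lt measurable_norm measurable_const)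
    (ContinuousLinearMap.measurable _) measurable_const

/-- A measurable jump integrand below an envelope is integrable. -/
theorem integrable_jumpIntegrand_of_le {c : Coeffs d m} (hc : c.Standing)
    {f : Rd d → Fin m → ℝ} {i : Fin m} (hf : ContDiff ℝ 2 fun y => f y i) {x : Rd d} {a b : ℝ}
    (ha : 0 ≤ a) (hb : 0 ≤ b) (h : ∀ z, |Coeffs.jumpIntegrand f x i z| ≤ jumpEnvelope a b z) :
    Integrable (Coeffs.jumpIntegrand f x i) (c.jumpMeasure x i) := by
  obtain ⟨C, -, hC⟩ := exists_jump_constant hc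
  exact (hC x i a b ha hb).1.mono' (measurable_jumpIntegrand hf x).aestronglyMeasurable
    (Eventually.of_forall h)

theorem abs_jumpIntegrand_le {f : Rd d → Fin m → ℝ} {i : Fin m}
    (hf : ContDiff ℝ 2 fun y => f y i) {x : Rd d} {K B : ℝ}
    (hK : ∀ y ∈ Metric.closedBall x 1, ‖fderiv ℝ (fderiv ℝ fun y => f y i) y‖ ≤ K)
    (hB : ∀ y, |f y i| ≤ B) (z : Rd d) :
    |Coeffs.jumpIntegrand f x i z| ≤ jumpEnvelope K (2 * B) z := by
  unfold Coeffs.jumpIntegrand jumpEnvelope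
  split_ifs with hz
  · refine abs_taylor_le hf (convex_closedBall x 1) hK (by simp) ?_
    simpa using hz.le
  · rw [sub_zero]
    have h1 := hB (x + z)
    have h2 := hB x
    rw [abs_le] at *
    constructor <;> linarith

/-- The jump integrand of a bounded function of class `C²` is integrable. -/
theorem integrable_jumpIntegrand {c : Coeffs d m} (hc : c.Standing)
    {f : Rd d → Fin m → ℝ} {i : Fin m} (hf : ContDiff ℝ 2 fun y => f y i) {B : ℝ}
    (hB : ∀ y, |f y i| ≤ B) (x : Rd d) :
    Integrable (Coeffs.jumpIntegrand f x i) (c.jumpMeasure x i) := by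
  obtain ⟨K, hK0, hK⟩ := exists_norm_fderiv_fderiv_le hf x 1
  have hB0 : 0 ≤ B := (abs_nonneg _).trans (hB x)
  exact integrable_jumpIntegrand_of_le hc hf hK0 (by positivity) (abs_jumpIntegrand_le hf hK hB)

section Linear

variable {f g : Rd d → Fin m → ℝ} {i : Fin m}

theorem jumpIntegrand_add_const_mul (hf : ContDiff ℝ 2 fun y => f y i)
    (hg : ContDiff ℝ 2 fun y => g y i) (k : ℝ) (x : Rd d) :
    Coeffs.jumpIntegrand (fun y j => f y j + k * g y j) x i =
      fun z => Coeffs.jumpIntegrand f x i z + k * Coeffs.jumpIntegrand g x i z := by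
  funext z
  have h1 := (hf.differentiable (by norm_num)) x
  have h2 := (hg.differentiable (by norm_num)) x
  have : fderiv ℝ (fun y => f y i + k * g y i) x =
      fderiv ℝ (fun y => f y i) x + k • fderiv ℝ (fun y => g y i) x := by
    rw [fderiv_fun_add h1 (h2.const_mul k), fderiv_const_mul h2]
  simp only [Coeffs.jumpIntegrand, this]
  split_ifs <;> simp <;> ring

theorem integrable_jumpIntegrand_add_const_mul {μ : Measure (Rd d)}
    (hf : ContDiff ℝ 2 fun y => f y i) (hg : ContDiff ℝ 2 fun y => g y i) (k : ℝ) {x : Rd d}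
    (hfi : Integrable (Coeffs.jumpIntegrand f x i) μ)
    (hgi : Integrable (Coeffs.jumpIntegrand g x i) μ) :
    Integrable (Coeffs.jumpIntegrand (fun y j => f y j + k * g y j) x i) μ := by
  rw [jumpIntegrand_add_const_mul hf hg]
  exact hfi.add (hgi.const_mul k)

/-- The generator is linear where the jump parts converge. -/
theorem gen_add_const_mul (c : Coeffs d m) (hf : ContDiff ℝ 2 fun y => f y i)
    (hg : ContDiff ℝ 2 fun y => g y i) (k : ℝ) {x : Rd d}
    (hfi : Integrable (Coeffs.jumpIntegrand f x i) (c.jumpMeasure x i))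
    (hgi : Integrable (Coeffs.jumpIntegrand g x i) (c.jumpMeasure x i)) :
    c.gen (fun y j => f y j + k * g y j) x i = c.gen f x i + k * c.gen g x i := by
  have h1 := (hf.differentiable (by norm_num)) x
  have h2 := (hg.differentiable (by norm_num)) x
  have e1 : fderiv ℝ (fun y => f y i + k * g y i) x =
      fderiv ℝ (fun y => f y i) x + k • fderiv ℝ (fun y => g y i) x := by
    rw [fderiv_fun_add h1 (h2.const_mul k), fderiv_const_mul h2]
  have e2 : iteratedFDeriv ℝ 2 (fun y => f y i + k * g y i) x =
      iteratedFDeriv ℝ 2 (fun y => f y i) x + k • iteratedFDeriv ℝ 2 (fun y => g y i) x := by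
    have hg' : ContDiffAt ℝ ((2 : ℕ) : WithTop ℕ∞) (fun y => g y i) x := hg.contDiffAt
    rw [← iteratedFDeriv_const_smul_apply (a := k) hg']
    exact iteratedFDeriv_add_apply (i := 2) hf.contDiffAt (hg'.const_smul k)
  simp only [Coeffs.gen, e1, e2, jumpIntegrand_add_const_mul hf hg]
  rw [integral_add hfi (hgi.const_mul k), integral_const_mul]
  simp only [add_apply, smul_apply, smul_eq_mul, mul_add, Finset.sum_add_distrib,
    Finset.mul_sum]
  simp only [← Finset.mul_sum, mul_left_comm _ k]
  ring

end Linear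

theorem jumpIntegrand_const (k : ℝ) (x : Rd d) (i : Fin m) :
    Coeffs.jumpIntegrand (fun _ _ => k) x i = 0 := by
  funext z
  simp [Coeffs.jumpIntegrand]

theorem gen_const {c : Coeffs d m} (hc : c.Standing) (k : ℝ) (x : Rd d) (i : Fin m) :
    c.gen (fun _ _ => k) x i = 0 := by
  have h2 : iteratedFDeriv ℝ 2 (fun _ : Rd d => k) x = 0 := by
    ext v; simp [iteratedFDeriv_two_apply]
  simp only [Coeffs.gen, jumpIntegrand_const, h2]
  simp [← Finset.sum_mul, hc.q_rowsum]

/-- Comparison: if `f ≤ g` in regime `i` and `f = g` near `x`, then `G f ≤ G g` at `(x,i)`. -/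
theorem gen_le_gen_of_eventuallyEq {c : Coeffs d m} {f g : Rd d → Fin m → ℝ} {x : Rd d}
    {i : Fin m} (hfi : Integrable (Coeffs.jumpIntegrand f x i) (c.jumpMeasure x i))
    (hgi : Integrable (Coeffs.jumpIntegrand g x i) (c.jumpMeasure x i))
    (hle : ∀ y, f y i ≤ g y i) (heq : ∀ j, (fun y => f y j) =ᶠ[𝓝 x] fun y => g y j) :
    c.gen f x i ≤ c.gen g x i := by
  have e0 : ∀ j, f x j = g x j := fun j => (heq j).eq_of_nhds
  have e1 : fderiv ℝ (fun y => f y i) x = fderiv ℝ (fun y => g y i) x := (heq i).fderiv_eq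
  have e2 : iteratedFDeriv ℝ 2 (fun y => f y i) x = iteratedFDeriv ℝ 2 (fun y => g y i) x :=
    ((heq i).iteratedFDeriv ℝ 2).eq_of_nhds
  have hint : ∫ z, Coeffs.jumpIntegrand f x i z ∂(c.jumpMeasure x i) ≤
      ∫ z, Coeffs.jumpIntegrand g x i z ∂(c.jumpMeasure x i) := by
    refine integral_mono hfi hgi fun z => ?_
    simp only [Coeffs.jumpIntegrand, e0, e1]
    have := hle (x + z)
    gcongr
  simp only [Coeffs.gen, e0, e1, e2]
  gcongr

/-! ### The generator on compactly supported functions -/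

theorem continuous_a {c : Coeffs d m} (hc : c.Standing) (i : Fin m) (k l : Fin d) :
    Continuous fun x => c.a x i k l := by
  have h := hc.sig_cont i
  have : Continuous fun x => c.sig x i * (c.sig x i).transpose := h.matrix_mul h.matrix_transpose
  exact this.matrix_elem k l

theorem continuous_b {c : Coeffs d m} (hc : c.Standing) (i : Fin m) (k : Fin d) :
    Continuous fun x => c.b x i k :=
  (EuclideanSpace.proj (𝕜 := ℝ) k).continuous.comp (hc.b_cont i)

theorem continuous_iteratedFDeriv_two_apply {g : Rd d → ℝ} (hg : ContDiff ℝ 2 g)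
    (v : Fin 2 → Rd d) : Continuous fun x => iteratedFDeriv ℝ 2 g x v :=
  (ContinuousMultilinearMap.apply ℝ (fun _ : Fin 2 => Rd d) ℝ v).continuous.comp
    (hg.continuous_iteratedFDeriv (m := 2) (by norm_num))

theorem hasCompactSupport_iteratedFDeriv_two_apply {g : Rd d → ℝ} (hg : HasCompactSupport g)
    (v : Fin 2 → Rd d) : HasCompactSupport fun x => iteratedFDeriv ℝ 2 g x v := by
  refine HasCompactSupport.intro (hg.iteratedFDeriv (𝕜 := ℝ) 2).isCompact fun x hx => ?_
  rw [image_eq_zero_of_notMem_tsupport hx]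
  rfl

theorem continuous_fderiv_apply_const {g : Rd d → ℝ} (hg : ContDiff ℝ 2 g) (v : Rd d) :
    Continuous fun x => fderiv ℝ g x v :=
  (hg.continuous_fderiv (by norm_num)).clm_apply continuous_const

theorem measurable_integral_jumpIntegrand {c : Coeffs d m} (hc : c.Standing)
    {f : Rd d → Fin m → ℝ} {i : Fin m} (hf : ContDiff ℝ 2 fun y => f y i) :
    Measurable fun x => ∫ z, Coeffs.jumpIntegrand f x i z ∂(c.jumpMeasure x i) := by
  have hJ : Measurable fun p : Rd d × Rd d => Coeffs.jumpIntegrand f p.1 i p.2 := by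
    unfold Coeffs.jumpIntegrand
    have h : Measurable fun y => f y i := hf.continuous.measurable
    refine ((h.comp (measurable_fst.add measurable_snd)).sub (h.comp measurable_fst)).sub ?_
    refine Measurable.ite (measurableSet_lt (measurable_norm.comp measurable_snd)
      measurable_const) ?_ measurable_const
    exact (((hf.continuous_fderiv (by norm_num)).comp continuous_fst).clm_apply
      continuous_snd).measurable
  have heq : (fun x => ∫ z, Coeffs.jumpIntegrand f x i z ∂(c.jumpMeasure x i)) =
      fun x => ∫ z, c.pit x i z * Coeffs.jumpIntegrand f x i z := by
    funext x
    have hm : Measurable fun z => ENNReal.ofReal (c.pit x i z) :=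
      ((hc.pit_meas i).comp measurable_prodMk_left).ennreal_ofReal
    rw [Coeffs.jumpMeasure, integral_withDensity_eq_integral_toReal_smul hm
      (Eventually.of_forall fun _ => ENNReal.ofReal_lt_top)]
    simp [ENNReal.toReal_ofReal (hc.pit_nonneg _ _ _)]
  rw [heq]
  exact (StronglyMeasurable.integral_prod_right
    (f := fun x z => c.pit x i z * Coeffs.jumpIntegrand f x i z)
    ((hc.pit_meas i).mul hJ).stronglyMeasurable).measurable

theorem measurable_gen {c : Coeffs d m} (hc : c.Standing) {f : Rd d → Fin m → ℝ}
    (hf : ∀ i, ContDiff ℝ 2 fun y => f y i) :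
    Measurable fun p : Rd d × Fin m => c.gen f p.1 p.2 := by
  refine measurable_from_prod_countable_left fun i => ?_
  unfold Coeffs.gen
  refine ((Measurable.add ?_ ?_).add (measurable_integral_jumpIntegrand hc (hf i))).add ?_
  · refine (Finset.measurable_sum _ fun k _ => Finset.measurable_sum _ fun l _ => ?_).const_mul _
    exact ((continuous_a hc i k l).mul
      (continuous_iteratedFDeriv_two_apply (hf i) _)).measurable
  · refine Finset.measurable_sum _ fun k _ => ?_
    exact ((continuous_b hc i k).mul (continuous_fderiv_apply_const (hf i) _)).measurable
  · exact Finset.measurable_sum _ fun j _ => (hc.q_meas i j).mul (hf j).continuous.measurable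

theorem exists_abs_integral_jumpIntegrand_le {c : Coeffs d m} (hc : c.Standing)
    {f : Rd d → Fin m → ℝ} {i : Fin m} (hf : ContDiff ℝ 2 fun y => f y i)
    (hs : HasCompactSupport fun y => f y i) :
    ∃ C : ℝ, ∀ x, |∫ z, Coeffs.jumpIntegrand f x i z ∂(c.jumpMeasure x i)| ≤ C := by
  obtain ⟨B, hB⟩ := hf.continuous.bounded_above_of_compact_support hs
  have hs2 : HasCompactSupport (fderiv ℝ (fderiv ℝ fun y => f y i)) := (hs.fderiv ℝ).fderiv ℝ
  have hB0 : 0 ≤ B := (norm_nonneg _).trans (hB 0)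
  obtain ⟨ρ, hρ⟩ := hs2.isCompact.isBounded.subset_closedBall 0
  obtain ⟨K, hK0, hK⟩ := exists_norm_fderiv_fderiv_le hf 0 (max ρ 0 + 2)
  obtain ⟨C, hC0, hC⟩ := exists_jump_constant hc
  have key : ∀ x a, 0 ≤ a →
      (∀ y ∈ Metric.closedBall x 1, ‖fderiv ℝ (fderiv ℝ fun y => f y i) y‖ ≤ a) →
      |∫ z, Coeffs.jumpIntegrand f x i z ∂(c.jumpMeasure x i)| ≤
        C * (a * (1 + ‖x‖ ^ 2) + 2 * B) := by
    intro x a ha h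
    obtain ⟨h1, h2⟩ := hC x i a (2 * B) ha (by positivity)
    refine le_trans ?_ h2
    rw [← Real.norm_eq_abs]
    refine norm_integral_le_of_norm_le h1 (Eventually.of_forall fun z => ?_)
    exact abs_jumpIntegrand_le hf h hB z
  refine ⟨C * (K * (1 + (max ρ 0 + 1) ^ 2) + 2 * B), fun x => ?_⟩
  by_cases hx : ‖x‖ ≤ max ρ 0 + 1
  · refine (key x K hK0 fun y hy => hK y ?_).trans ?_
    · rw [mem_closedBall_iff_norm] at hy ⊢
      have := norm_le_norm_add_norm_sub' y x
      rw [sub_zero]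
      linarith
    · gcongr
  · refine (key x 0 le_rfl fun y hy => ?_).trans ?_
    · have : y ∉ tsupport (fderiv ℝ (fderiv ℝ fun y => f y i)) := fun hy' => by
        have h1 := hρ hy'
        rw [mem_closedBall_iff_norm] at hy h1
        rw [sub_zero] at h1
        have := norm_le_norm_add_norm_sub y x
        have := le_max_left ρ 0
        linarith
      rw [image_eq_zero_of_notMem_tsupport this]
      exact (norm_zero (E := Rd d →L[ℝ] Rd d →L[ℝ] ℝ)).le
    · rw [zero_mul]
      gcongr
      positivity

/-- The generator maps compactly supported functions of class `C²` to bounded functions. -/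
theorem exists_abs_gen_le {c : Coeffs d m} (hc : c.Standing) {f : Rd d → Fin m → ℝ}
    (hf : ∀ i, ContDiff ℝ 2 fun y => f y i) (hs : ∀ i, HasCompactSupport fun y => f y i) :
    ∃ C : ℝ, ∀ x i, |c.gen f x i| ≤ C := by
  suffices h : ∀ i, ∃ C : ℝ, ∀ x, |c.gen f x i| ≤ C by
    choose C hC using h
    obtain ⟨M, hM⟩ := (Set.finite_range C).bddAbove
    exact ⟨M, fun x i => (hC i x).trans (hM (mem_range_self i))⟩
  intro i
  have h2 : ∀ k l, ∃ C : ℝ, ∀ x, |c.a x i k l * iteratedFDeriv ℝ 2 (fun y => f y i) x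
        ![EuclideanSpace.single k (1 : ℝ), EuclideanSpace.single l (1 : ℝ)]| ≤ C := by
    intro k l
    refine ((continuous_a hc i k l).mul
      (continuous_iteratedFDeriv_two_apply (hf i) _)).bounded_above_of_compact_support ?_
    exact (hasCompactSupport_iteratedFDeriv_two_apply (hs i) _).mul_left
  have h1 : ∀ k, ∃ C : ℝ, ∀ x, |c.b x i k * fderiv ℝ (fun y => f y i) x
        (EuclideanSpace.single k (1 : ℝ))| ≤ C := by
    intro k
    refine ((continuous_b hc i k).mul
      (continuous_fderiv_apply_const (hf i) _)).bounded_above_of_compact_support ?_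
    exact ((hs i).fderiv_apply ℝ _).mul_left
  have h0 : ∀ j, ∃ C : ℝ, ∀ x, |c.q x i j * f x j| ≤ C := by
    intro j
    obtain ⟨A, hA⟩ := hc.q_bdd i j
    obtain ⟨B, hB⟩ := (hf j).continuous.bounded_above_of_compact_support (hs j)
    refine ⟨A * B, fun x => ?_⟩
    rw [abs_mul]
    exact mul_le_mul (hA x) (hB x) (abs_nonneg _) ((abs_nonneg _).trans (hA x))
  choose A hA using h2
  choose B hB using h1
  choose Q hQ using h0
  obtain ⟨J, hJ⟩ := exists_abs_integral_jumpIntegrand_le hc (hf i) (hs i)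
  refine ⟨|(1 / 2 : ℝ)| * (∑ k, ∑ l, A k l) + (∑ k, B k) + J + ∑ j, Q j, fun x => ?_⟩
  unfold Coeffs.gen
  refine (abs_add_le _ _).trans (add_le_add ((abs_add_le _ _).trans (add_le_add
    ((abs_add_le _ _).trans (add_le_add ?_ ?_)) (hJ x))) ?_)
  · rw [abs_mul]
    gcongr
    refine (Finset.abs_sum_le_sum_abs _ _).trans (Finset.sum_le_sum fun k _ => ?_)
    exact (Finset.abs_sum_le_sum_abs _ _).trans (Finset.sum_le_sum fun l _ => hA k l x)
  · exact (Finset.abs_sum_le_sum_abs _ _).trans (Finset.sum_le_sum fun k _ => hB k x)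
  · exact (Finset.abs_sum_le_sum_abs _ _).trans (Finset.sum_le_sum fun j _ => hQ j x)

theorem isCb2_of_hasCompactSupport {f : Rd d → Fin m → ℝ}
    (hf : ∀ i, ContDiff ℝ 2 fun y => f y i) (hs : ∀ i, HasCompactSupport fun y => f y i) :
    IsCb2 f := by
  refine ⟨hf, fun i => ?_⟩
  obtain ⟨A, hA⟩ := (hf i).continuous.bounded_above_of_compact_support (hs i)
  obtain ⟨B, hB⟩ := ((hf i).continuous_fderiv (by norm_num)).bounded_above_of_compact_support
    ((hs i).fderiv ℝ)
  obtain ⟨C, hC⟩ := ((hf i).continuous_iteratedFDeriv (m := 2)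
    (by norm_num)).bounded_above_of_compact_support ((hs i).iteratedFDeriv (𝕜 := ℝ) 2)
  exact ⟨max A (max B C), fun x => ⟨(hA x).trans (le_max_left _ _),
    (hB x).trans ((le_max_left _ _).trans (le_max_right _ _)),
    (hC x).trans ((le_max_right _ _).trans (le_max_right _ _))⟩⟩

/-! ### Càdlàg paths and hitting times of open sets -/

/-- A path hits an open set before `a` if and only if it does so at a time of a given dense set. -/
theorem hit_lt_iff_of_dense {S : Set ℝ≥0} (hS : Dense S) {U : Set (Rd d × Fin m)}
    (hU : IsOpen U) (w : CadlagPath d m) (a : ℝ≥0∞) :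
    hit U w < a ↔ ∃ q ∈ S, (q : ℝ≥0∞) < a ∧ Z q w ∈ U := by
  simp only [hit, iInf_lt_iff, exists_prop]
  constructor
  · rintro ⟨t, htU, hta⟩
    have h1 : ∀ᶠ u in 𝓝[>] t, Z u w ∈ U :=
      ((w.2.1 t).mono Ioi_subset_Ici_self).eventually (hU.mem_nhds htU)
    have h2 : ∀ᶠ u : ℝ≥0 in 𝓝[>] t, (u : ℝ≥0∞) < a :=
      ((ENNReal.continuous_coe.tendsto t).mono_left nhdsWithin_le_nhds).eventually
        (gt_mem_nhds hta)
    obtain ⟨u, htu, hu⟩ := (mem_nhdsGT_iff_exists_Ioo_subset (a := t)).1 (h1.and h2)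
    obtain ⟨q, hq, hq'⟩ := hS.exists_between htu
    exact ⟨q, hq, (hu hq').2, (hu hq').1⟩
  · rintro ⟨q, -, hqa, hqU⟩
    exact ⟨q, hqU, hqa⟩

theorem measurable_hit {U : Set (Rd d × Fin m)} (hU : IsOpen U) :
    Measurable (hit U : CadlagPath d m → ℝ≥0∞) := by
  obtain ⟨S, hSc, hS⟩ := TopologicalSpace.exists_countable_dense ℝ≥0
  refine measurable_of_Iio fun a => ?_
  have : (hit U : CadlagPath d m → ℝ≥0∞) ⁻¹' Iio a =
      ⋃ q ∈ S, {w | (q : ℝ≥0∞) < a ∧ Z q w ∈ U} := by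
    ext w
    simp only [mem_preimage, mem_Iio, hit_lt_iff_of_dense hS hU, mem_iUnion, mem_ofPred_eq,
      exists_prop]
  rw [this]
  refine MeasurableSet.biUnion hSc fun q _ => ?_
  exact (MeasurableSet.const _).inter (measurable_Z q hU.measurableSet)

theorem measurableSet_filt_hit_lt {U : Set (Rd d × Fin m)} (hU : IsOpen U) (s : ℝ≥0) :
    MeasurableSet[filt d m s] {w : CadlagPath d m | hit U w < s} := by
  obtain ⟨S, hSc, hS⟩ := TopologicalSpace.exists_countable_dense ℝ≥0
  have : {w : CadlagPath d m | hit U w < s} = ⋃ q ∈ S ∩ Iio s, {w | Z q w ∈ U} := by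
    ext w
    simp only [mem_ofPred_eq, hit_lt_iff_of_dense hS hU, ENNReal.coe_lt_coe, mem_iUnion,
      mem_inter_iff, mem_Iio, exists_prop]
    tauto
  rw [this]
  refine MeasurableSet.biUnion (hSc.mono inter_subset_left) fun q hq => ?_
  refine Filtration.le_rightCont _ s _ ?_
  have hle : MeasurableSpace.comap (Z q : CadlagPath d m → Rd d × Fin m) inferInstance ≤
      Filtration.natural Z (fun t => (measurable_Z (d := d) (m := m) t).stronglyMeasurable) s :=
    le_iSup₂_of_le q hq.2.le le_rfl
  exact hle _ ⟨U, hU.measurableSet, rfl⟩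

theorem notMem_of_lt_hit {U : Set (Rd d × Fin m)} {w : CadlagPath d m} {t : ℝ≥0}
    (h : (t : ℝ≥0∞) < hit U w) : Z t w ∉ U := fun hU =>
  absurd (iInf₂_le t hU : hit U w ≤ t) (not_le.2 h)

theorem hit_anti {U U' : Set (Rd d × Fin m)} (h : U ⊆ U') (w : CadlagPath d m) :
    hit U' w ≤ hit U w :=
  le_iInf₂ fun t ht => iInf₂_le t (h ht)

/-- A right continuous path is measurable. -/
theorem measurable_path (w : CadlagPath d m) : Measurable fun t : ℝ≥0 => Z t w := by
  have hmeas : ∀ n : ℕ, Measurable fun t : ℝ≥0 =>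
      Z (((⌊t * (n + 1)⌋₊ : ℝ≥0) + 1) / (n + 1)) w := fun n => by
    have h1 : Measurable fun t : ℝ≥0 => ⌊t * (n + 1)⌋₊ :=
      Nat.measurable_floor.comp (measurable_id.mul_const _)
    exact (measurable_from_nat (f := fun k : ℕ => Z (((k : ℝ≥0) + 1) / (n + 1)) w)).comp h1
  refine measurable_of_tendsto_metrizable hmeas (tendsto_pi_nhds.2 fun t => ?_)
  refine (w.2.1 t).tendsto.comp (tendsto_nhdsWithin_iff.2 ⟨?_, Eventually.of_forall fun n => ?_⟩)
  · have hlow : ∀ n : ℕ, t ≤ ((⌊t * (n + 1)⌋₊ : ℝ≥0) + 1) / (n + 1) := fun n => by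
      rw [le_div_iff₀ (by positivity)]
      exact (Nat.lt_floor_add_one _).le
    have hup : ∀ n : ℕ, ((⌊t * (n + 1)⌋₊ : ℝ≥0) + 1) / (n + 1) ≤ t + 1 / (n + 1) := fun n => by
      rw [div_le_iff₀ (by positivity), add_mul, div_mul_cancel₀ _ (by positivity)]
      gcongr
      exact Nat.floor_le (by positivity)
    refine tendsto_of_tendsto_of_tendsto_of_le_of_le tendsto_const_nhds ?_ hlow hup
    simpa using tendsto_const_nhds.add (tendsto_one_div_add_atTop_nhds_zero_nat (𝕜 := ℝ≥0))
  · change t ≤ ((⌊t * (n + 1)⌋₊ : ℝ≥0) + 1) / (n + 1)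
    rw [le_div_iff₀ (by positivity)]
    exact (Nat.lt_floor_add_one _).le

/-- A càdlàg path is bounded on bounded time intervals. -/
theorem exists_norm_path_le (w : CadlagPath d m) (T : ℝ≥0) :
    ∃ R : ℝ, ∀ t ≤ T, ‖(Z t w).1‖ ≤ R := by
  have key : ∃ R : ℝ, ∀ t ∈ Icc 0 T, ‖(Z t w).1‖ ≤ R := by
    refine isCompact_Icc.induction_on (p := fun s => ∃ R : ℝ, ∀ t ∈ s, ‖(Z t w).1‖ ≤ R)
      ⟨0, by simp⟩ (fun s t hst ⟨R, hR⟩ => ⟨R, fun u hu => hR u (hst hu)⟩) ?_ ?_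
    · rintro s t ⟨R, hR⟩ ⟨R', hR'⟩
      refine ⟨max R R', fun u hu => ?_⟩
      rcases hu with hu | hu
      · exact (hR u hu).trans (le_max_left _ _)
      · exact (hR' u hu).trans (le_max_right _ _)
    · intro t _
      have bound : ∀ (F : Filter ℝ≥0) (L : Rd d × Fin m), Tendsto w.1 F (𝓝 L) →
          ∀ᶠ u in F, ‖(Z u w).1‖ ≤ ‖L.1‖ + 1 := fun F L h =>
        ((continuous_fst.norm.tendsto L).comp h).eventually (Iic_mem_nhds (lt_add_one _))
      have hr := bound _ _ (w.2.1 t)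
      have hl : ∃ R : ℝ, ∀ᶠ u in 𝓝[<] t, ‖(Z u w).1‖ ≤ R := by
        rcases eq_or_lt_of_le (zero_le (a := t)) with h0 | h0
        · refine ⟨0, ?_⟩
          rw [← h0]
          simp
        · obtain ⟨L, hL⟩ := w.2.2 t h0
          exact ⟨_, bound _ _ hL⟩
      obtain ⟨R, hR⟩ := hl
      refine ⟨{u | ‖(Z u w).1‖ ≤ max R (‖(w.1 t).1‖ + 1)}, ?_, _, fun u hu => hu⟩
      refine mem_nhdsWithin_of_mem_nhds ?_
      rw [← nhdsLT_sup_nhdsGE t]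
      exact ⟨hR.mono fun u hu => hu.trans (le_max_left _ _),
        hr.mono fun u hu => hu.trans (le_max_right _ _)⟩
  obtain ⟨R, hR⟩ := key
  exact ⟨R, fun t ht => hR t ⟨zero_le, ht⟩⟩

/-! ### Dynkin's inequality -/

open Classical in
/-- Summing increments as long as a decreasing predicate holds stops the sequence at the first
failure of the predicate. -/
theorem exists_sum_ite_increments (p : ℕ → Prop) (hp : ∀ k, p (k + 1) → p k) (g : ℕ → ℝ) (N : ℕ) :
    ∃ j ≤ N, (∀ k < j, p k) ∧ (j = N ∨ ¬ p j) ∧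
      ∑ k ∈ Finset.range N, (if p k then g (k + 1) - g k else 0) = g j - g 0 := by
  have hanti : ∀ k n, k ≤ n → p n → p k := fun k n hkn =>
    Nat.le_induction (P := fun n _ => p n → p k) id (fun n _ ih h => ih (hp n h)) n hkn
  induction N with
  | zero => exact ⟨0, le_rfl, by simp, Or.inl rfl, by simp⟩
  | succ N ih =>
    obtain ⟨j, hj, hlt, hor, hsum⟩ := ih
    rw [Finset.sum_range_succ, hsum]
    by_cases hN : p N
    · have hjN : j = N := hor.resolve_right fun h => h (hanti j N hj hN)
      subst hjN
      refine ⟨j + 1, le_rfl, fun k hk => hanti k j (Nat.lt_succ_iff.1 hk) hN, Or.inl rfl, ?_⟩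
      rw [if_pos hN]
      ring
    · refine ⟨j, hj.trans (Nat.le_succ N), hlt, Or.inr ?_, by rw [if_neg hN, add_zero]⟩
      rcases hor with rfl | h
      · exact hN
      · exact h

/-- Along a path, the integral of a function that is at most `-ε` until the hitting time of `O`. -/
theorem integral_path_le {O : Set (Rd d × Fin m)} {G : Rd d × Fin m → ℝ} (hG : Measurable G)
    {C ε : ℝ} (hC : ∀ p, |G p| ≤ C) (hε : ∀ p ∉ O, G p ≤ -ε) (w : CadlagPath d m)
    {s t : ℝ≥0} (hst : s ≤ t) (hs : (s : ℝ≥0∞) ≤ hit O w) :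
    ∫ u in Ioc (0 : ℝ) t, G (Z u.toNNReal w) ≤ -ε * s + C * (t - s) := by
  have hmeas : Measurable fun u : ℝ => G (Z u.toNNReal w) :=
    hG.comp ((measurable_path w).comp measurable_real_toNNReal)
  have hint : ∀ a b : ℝ, IntegrableOn (fun u : ℝ => G (Z u.toNNReal w)) (Ioc a b) := fun a b =>
    Measure.integrableOn_of_bounded (M := C) (by simp) hmeas.aestronglyMeasurable
      (Eventually.of_forall fun u => hC _)
  have hst' : (s : ℝ) ≤ t := hst
  rw [← Ioc_union_Ioc_eq_Ioc s.coe_nonneg hst',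
    setIntegral_union (Ioc_disjoint_Ioc_of_le le_rfl) measurableSet_Ioc (hint _ _) (hint _ _)]
  refine add_le_add ?_ ?_
  · rw [integral_Ioc_eq_integral_Ioo]
    refine (setIntegral_mono_on ((hint _ _).mono_set Ioo_subset_Ioc_self)
      (integrableOn_const (by simp)) measurableSet_Ioo
      (g := fun _ => -ε) fun u hu => hε _ (notMem_of_lt_hit ?_)).trans_eq ?_
    · refine lt_of_lt_of_le ?_ hs
      exact_mod_cast (Real.toNNReal_lt_iff_lt_coe hu.1.le).2 hu.2
    · simp [mul_comm]
  · refine (setIntegral_mono_on (hint _ _) (integrableOn_const (by simp)) measurableSet_Ioc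
      (g := fun _ => C) fun u _ => (le_abs_self _).trans (hC _)).trans_eq ?_
    simp [hst', mul_comm]

/-- Dynkin's inequality for a compactly supported function of class `C²`. -/
theorem integral_min_hit_le {c : Coeffs d m} (hc : c.Standing) {x : Rd d} {i : Fin m}
    {ν : Measure (CadlagPath d m)} (hν : SolvesMP c x i ν) {f : Rd d → Fin m → ℝ}
    (hf : ∀ i, ContDiff ℝ 2 fun y => f y i) (hs : ∀ i, HasCompactSupport fun y => f y i)
    (hf0 : ∀ x i, 0 ≤ f x i) {O : Set (Rd d × Fin m)} (hO : IsOpen O) {ε : ℝ} (hε : 0 < ε)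
    (hgen : ∀ p ∉ O, c.gen f p.1 p.2 ≤ -ε) (T : ℝ≥0) :
    ∫⁻ w, min (hit O w) T ∂ν ≤ ENNReal.ofReal (f x i / ε) := by
  classical
  have := hν.prob
  obtain ⟨C, hC⟩ := exists_abs_gen_le hc hf hs
  have hC0 : 0 ≤ C := (abs_nonneg _).trans (hC x i)
  have hGm := measurable_gen hc hf
  have hmart := hν.martingale f (isCb2_of_hasCompactSupport hf hs)
  set M : ℝ≥0 → CadlagPath d m → ℝ := fun t w => f (Z t w).1 (Z t w).2 - f x i -
    ∫ u in Set.Ioc (0 : ℝ) (t : ℝ), c.gen f (Z u.toNNReal w).1 (Z u.toNNReal w).2 with hM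
  set H : CadlagPath d m → ℝ := fun w => (min (hit O w) T).toReal with hH
  have htop : ∀ w : CadlagPath d m, min (hit O w) T ≠ ⊤ := fun w =>
    ((min_le_right _ _).trans_lt ENNReal.coe_lt_top).ne
  have hHT : ∀ w, H w ≤ T := fun w =>
    ENNReal.toReal_le_coe_of_le_coe (min_le_right (hit O w) (T : ℝ≥0∞))
  have hHm : Measurable H := ((measurable_hit hO).min measurable_const).ennreal_toReal
  have hHi : Integrable H ν := Integrable.of_bound hHm.aestronglyMeasurable (T : ℝ)
    (Eventually.of_forall fun w => by
      rw [Real.norm_of_nonneg ENNReal.toReal_nonneg]; exact hHT w)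
  have hstart : ∀ᵐ w ∂ν, Z 0 w = (x, i) := by
    refine (prob_compl_eq_zero_iff ?_).2 hν.init
    exact measurable_Z 0 (measurableSet_singleton (x, i))
  have step : ∀ N : ℕ, ε * ∫ w, H w ∂ν ≤ f x i + (ε + C) * (T / (N + 1)) := by
    intro N
    set h : ℝ≥0 := T / (N + 1) with hh
    let s : ℕ → ℝ≥0 := fun k => k * h
    have hsN : s (N + 1) = T := by
      simp only [s, hh, Nat.cast_add, Nat.cast_one]
      exact mul_div_cancel₀ _ (by positivity)
    have hs1 : ∀ k, s (k + 1) = s k + h := fun k => by simp [s]; ring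
    have hmono : ∀ k, s k ≤ s (k + 1) := fun k => by rw [hs1]; exact le_self_add
    let A : ℕ → Set (CadlagPath d m) := fun k => {w | (s k : ℝ≥0∞) ≤ hit O w}
    have hA : ∀ k, MeasurableSet[filt d m (s k)] (A k) := fun k => by
      have := (measurableSet_filt_hit_lt hO (s k)).compl
      simpa [A, compl_ofPred] using this
    let Y : CadlagPath d m → ℝ := fun w => ∑ k ∈ Finset.range (N + 1),
      (A k).indicator (fun w => M (s (k + 1)) w - M (s k) w) w
    have hinc : ∀ k, Integrable ((A k).indicator fun w => M (s (k + 1)) w - M (s k) w) ν :=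
      fun k => ((hmart.integrable _).sub (hmart.integrable _)).indicator
        ((filt d m).le _ _ (hA k))
    have hYi : Integrable Y ν := integrable_finsetSum _ fun k _ => hinc k
    have hY0 : ∫ w, Y w ∂ν = 0 := by
      rw [integral_finsetSum _ fun k _ => hinc k]
      refine Finset.sum_eq_zero fun k _ => ?_
      rw [integral_indicator ((filt d m).le _ _ (hA k)),
        integral_sub (hmart.integrable _).integrableOn (hmart.integrable _).integrableOn,
        hmart.setIntegral_eq (hmono k) (hA k), sub_self]
    have hYle : ∀ᵐ w ∂ν, ε * H w - (f x i + (ε + C) * h) ≤ Y w := by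
      filter_upwards [hstart] with w hw
      obtain ⟨j, hj, hlt, hor, hsum⟩ := exists_sum_ite_increments (fun k => w ∈ A k)
        (fun k hk => le_trans (ENNReal.coe_le_coe.2 (hmono k)) (mem_ofPred.1 hk)) (fun k => M (s k) w) (N + 1)
      have hYw : Y w = M (s j) w - M (s 0) w := by
        refine Eq.trans (Finset.sum_congr rfl fun k _ => ?_) hsum
        by_cases hk : w ∈ A k <;> simp [hk]
      have hM0 : M (s 0) w = 0 := by
        simp [hM, s, hw]
      obtain ⟨k, rfl⟩ : ∃ k, j = k + 1 := by
        rcases j with _ | k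
        · exfalso
          rcases hor with h | h
          · omega
          · exact h (by simp [A, s])
        · exact ⟨k, rfl⟩
      have hk : (s k : ℝ≥0∞) ≤ hit O w := hlt k (Nat.lt_succ_self k)
      have hHs : H w ≤ s (k + 1) := by
        refine ENNReal.toReal_le_coe_of_le_coe ?_
        rcases hor with h | h
        · rw [h, hsN]; exact min_le_right _ _
        · exact (min_le_left _ _).trans (not_le.1 h).le
      have hI := integral_path_le hGm (fun p => hC p.1 p.2) hgen w (hmono k) hk
      have hfj := hf0 (Z (s (k + 1)) w).1 (Z (s (k + 1)) w).2
      have hsk : ((s (k + 1) : ℝ≥0) : ℝ) = s k + h := by rw [hs1]; rfl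
      rw [hYw, hM0, hM]
      dsimp only
      rw [hsk] at hI hHs ⊢
      have := mul_le_mul_of_nonneg_left hHs hε.le
      linarith
    have := integral_mono_ae ((hHi.const_mul ε).sub (integrable_const _)) hYi hYle
    rw [hY0, integral_sub' (hHi.const_mul ε) (integrable_const _), integral_const_mul] at this
    simp only [integral_const, probReal_univ, one_smul] at this
    have hcast : ((h : ℝ≥0) : ℝ) = T / (N + 1) := by simp [hh]
    rw [hcast] at this
    linarith
  have hlim : Tendsto (fun N : ℕ => f x i + (ε + C) * ((T : ℝ) / (N + 1))) atTop
      (𝓝 (f x i + (ε + C) * 0)) := by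
    refine tendsto_const_nhds.add (Tendsto.const_mul _ ?_)
    have := (tendsto_one_div_add_atTop_nhds_zero_nat (𝕜 := ℝ)).const_mul (T : ℝ)
    simpa [div_eq_mul_inv] using this
  have hfin : ε * ∫ w, H w ∂ν ≤ f x i := by
    simpa using ge_of_tendsto' hlim step
  have hfin' : ∫ w, H w ∂ν ≤ f x i / ε := by
    rw [le_div_iff₀ hε]; linarith
  calc ∫⁻ w, min (hit O w) T ∂ν = ∫⁻ w, ENNReal.ofReal (H w) ∂ν := by
        simp only [hH, ENNReal.ofReal_toReal (htop _)]
    _ = ENNReal.ofReal (∫ w, H w ∂ν) :=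
        (ofReal_integral_eq_lintegral_ofReal hHi
          (Eventually.of_forall fun w => ENNReal.toReal_nonneg)).symm
    _ ≤ _ := ENNReal.ofReal_le_ofReal hfin'

/-- Multiplying by a smooth cutoff that is one near `p` and comparing generators. -/
theorem gen_cutoff_le {c : Coeffs d m} (hc : c.Standing) {W : Rd d → Fin m → ℝ}
    (hW : ∀ i, ContDiff ℝ 2 fun y => W y i) (hW0 : ∀ x i, 0 ≤ W x i)
    (χ : ContDiffBump (0 : Rd d)) {x : Rd d} (hx : x ∈ Metric.ball 0 χ.rIn) {i : Fin m}
    (hi : Integrable (Coeffs.jumpIntegrand W x i) (c.jumpMeasure x i)) :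
    c.gen (fun y j => χ y * W y j) x i ≤ c.gen W x i := by
  have hcd : ContDiff ℝ 2 fun y => χ y * W y i := (χ.contDiff (n := 2)).mul (hW i)
  have hcs : HasCompactSupport fun y => χ y * W y i := χ.hasCompactSupport.mul_right
  obtain ⟨B, hB⟩ := hcd.continuous.bounded_above_of_compact_support hcs
  refine gen_le_gen_of_eventuallyEq (integrable_jumpIntegrand hc hcd hB x) hi
    (fun y => mul_le_of_le_one_left (hW0 y i) χ.le_one) fun j => ?_
  filter_upwards [χ.eventuallyEq_one_of_mem_ball hx] with y hy
  simp [hy]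

/-- A nonnegative function `W` of class `C²` with `GW ≤ -ε` off an open set `U` bounds the mean
hitting time of `U`. -/
theorem lintegral_hit_le {c : Coeffs d m} (hc : c.Standing) {x : Rd d} {i : Fin m}
    {ν : Measure (CadlagPath d m)} (hν : SolvesMP c x i ν) {W : Rd d → Fin m → ℝ}
    (hW : ∀ i, ContDiff ℝ 2 fun y => W y i) (hW0 : ∀ x i, 0 ≤ W x i)
    {U : Set (Rd d × Fin m)} (hU : IsOpen U) {ε : ℝ} (hε : 0 < ε)
    (hi : ∀ p ∉ U, Integrable (Coeffs.jumpIntegrand W p.1 p.2) (c.jumpMeasure p.1 p.2))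
    (hgen : ∀ p ∉ U, c.gen W p.1 p.2 ≤ -ε) :
    ∫⁻ w, hit U w ∂ν ≤ ENNReal.ofReal (W x i / ε) := by
  let O : ℕ → Set (Rd d × Fin m) := fun n => U ∪ {p | (n : ℝ) < ‖p.1‖}
  have hO : ∀ n, IsOpen (O n) := fun n =>
    hU.union (isOpen_lt continuous_const continuous_fst.norm)
  have hOanti : ∀ n k, n ≤ k → O k ⊆ O n := fun n k hnk =>
    union_subset_union_right _ fun p (hp : (k : ℝ) < ‖p.1‖) =>
      lt_of_le_of_lt (by exact_mod_cast hnk) hp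
  let F : ℕ → CadlagPath d m → ℝ≥0∞ := fun n w => min (hit (O n) w) (n : ℝ≥0)
  have hFm : ∀ n, Measurable (F n) := fun n => (measurable_hit (hO n)).min measurable_const
  have hFmono : Monotone F := fun n k hnk w =>
    min_le_min (hit_anti (hOanti n k hnk) w) (ENNReal.coe_le_coe.2 (Nat.cast_le.2 hnk))
  have hsup : ∀ w, hit U w ≤ ⨆ n, F n w := by
    intro w
    refine le_of_forall_lt fun a ha => ?_
    obtain ⟨b, hab, hb⟩ := exists_between ha
    lift b to ℝ≥0 using (hb.trans_le le_top).ne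
    obtain ⟨R, hR⟩ := exists_norm_path_le w b
    obtain ⟨n, hn⟩ := exists_nat_ge (max R b)
    refine hab.trans_le (le_iSup_of_le n (le_min (le_iInf₂ fun t ht => ?_) ?_))
    · rcases ht with ht | ht
      · exact hb.le.trans (iInf₂_le t ht)
      · by_contra hlt
        have htb : t ≤ b := by exact_mod_cast (not_le.1 hlt).le
        exact absurd (hR t htb) (not_le.2 (((le_max_left _ _).trans hn).trans_lt ht))
    · have : (b : ℝ) ≤ n := (le_max_right _ _).trans hn
      exact_mod_cast this
  calc ∫⁻ w, hit U w ∂ν ≤ ∫⁻ w, ⨆ n, F n w ∂ν := lintegral_mono hsup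
    _ = ⨆ n, ∫⁻ w, F n w ∂ν := lintegral_iSup hFm hFmono
    _ ≤ _ := iSup_le fun n => ?_
  let χ : ContDiffBump (0 : Rd d) := ⟨n + 1, n + 2, by positivity, by linarith⟩
  have hχ := fun j => (χ.contDiff (n := 2)).mul (hW j)
  refine (integral_min_hit_le hc hν (f := fun y j => χ y * W y j) hχ
    (fun j => χ.hasCompactSupport.mul_right) (fun y j => mul_nonneg χ.nonneg (hW0 y j)) (hO n) hε
    (fun p hp => ?_) (n : ℝ≥0)).trans ?_
  · have hpU : p ∉ U := fun h => hp (Or.inl h)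
    have hpn : ‖p.1‖ ≤ n := not_lt.1 fun h => hp (Or.inr h)
    refine (gen_cutoff_le hc hW hW0 χ ?_ (hi p hpU)).trans (hgen p hpU)
    rw [mem_ball_zero_iff]
    change ‖p.1‖ < (n : ℝ) + 1
    linarith
  · apply ENNReal.ofReal_le_ofReal
    gcongr
    exact mul_le_of_le_one_left (hW0 x i) χ.le_one

/-- A Lyapunov function off an open set `U` gives positive recurrence with respect to `U`. -/
theorem posRecurrent_of_lyapunov {c : Coeffs d m} (hc : c.Standing)
    {P : Kernel (Rd d × Fin m) (CadlagPath d m)} (hP : IsProcess c P) {W : Rd d → Fin m → ℝ}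
    (hW : ∀ i, ContDiff ℝ 2 fun y => W y i) (hW0 : ∀ x i, 0 ≤ W x i)
    {U : Set (Rd d × Fin m)} (hU : IsOpen U) {ε : ℝ} (hε : 0 < ε)
    (hi : ∀ p ∉ U, Integrable (Coeffs.jumpIntegrand W p.1 p.2) (c.jumpMeasure p.1 p.2))
    (hgen : ∀ p ∉ U, c.gen W p.1 p.2 ≤ -ε) : PosRecurrent P U := by
  have hfin : ∀ p, ∫⁻ w, hit U w ∂(P p) < ⊤ := fun p =>
    (lintegral_hit_le hc (hP.solves p.1 p.2) hW hW0 hU hε hi hgen).trans_lt ENNReal.ofReal_lt_top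
  refine ⟨fun p _ => ?_, fun p _ => hfin p⟩
  have := (hP.solves p.1 p.2).prob
  have hae : ∀ᵐ w ∂(P p), hit U w < ⊤ := ae_lt_top (measurable_hit hU) (hfin p).ne
  exact (prob_compl_eq_zero_iff (measurableSet_lt (measurable_hit hU) measurable_const)).1 hae

theorem PosRecurrent.mono {c : Coeffs d m} {P : Kernel (Rd d × Fin m) (CadlagPath d m)}
    (hP : IsProcess c P) {U U' : Set (Rd d × Fin m)} (h : U ⊆ U') (hU : PosRecurrent P U) :
    PosRecurrent P U' := by
  refine ⟨fun p hp => ?_, fun p hp => ?_⟩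
  · have := (hP.solves p.1 p.2).prob
    refine le_antisymm prob_le_one ((hU.1 p fun h' => hp (h h')).symm.le.trans (measure_mono ?_))
    exact fun w hw => (hit_anti h w).trans_lt hw
  · exact (lintegral_mono (hit_anti h)).trans_lt (hU.2 p fun h' => hp (h h'))

/-! ### The generator on Gaussian functions -/

section Gauss

variable {F : Type*} [NormedAddCommGroup F]

/-- The Gaussian bump `exp(-λ|x - x₀|²)`. -/
def gauss (lam : ℝ) (x₀ x : F) : ℝ := Real.exp (-lam * ‖x - x₀‖ ^ 2)

theorem gauss_pos (lam : ℝ) (x₀ x : F) : 0 < gauss lam x₀ x := Real.exp_pos _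

theorem gauss_le_one {lam : ℝ} (hl : 0 ≤ lam) (x₀ x : F) : gauss lam x₀ x ≤ 1 := by
  refine Real.exp_le_one_iff.2 ?_
  have : 0 ≤ lam * ‖x - x₀‖ ^ 2 := by positivity
  linarith

variable [InnerProductSpace ℝ F]

theorem contDiff_gauss (lam : ℝ) (x₀ : F) : ContDiff ℝ 2 (gauss lam x₀) :=
  (contDiff_const.mul ((contDiff_id.sub contDiff_const).norm_sq ℝ)).exp

theorem hasFDerivAt_gauss (lam : ℝ) (x₀ x : F) :
    HasFDerivAt (gauss lam x₀) ((-(2 * lam) * gauss lam x₀ x) • innerSL ℝ (x - x₀)) x := by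
  have h1 := ((hasFDerivAt_id x).sub_const x₀).norm_sq
  refine (h1.const_mul (-lam)).exp.congr_fderiv ?_
  ext v
  simp only [gauss, smul_apply, innerSL_apply_apply, smul_eq_mul, nsmul_eq_mul, id_eq,
    ContinuousLinearMap.comp_id]
  push_cast
  ring

theorem fderiv_gauss_apply (lam : ℝ) (x₀ x v : F) :
    fderiv ℝ (gauss lam x₀) x v = -(2 * lam) * gauss lam x₀ x * inner ℝ (x - x₀) v := by
  rw [(hasFDerivAt_gauss lam x₀ x).fderiv]
  rfl

theorem iteratedFDeriv_two_gauss (lam : ℝ) (x₀ x v w : F) :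
    iteratedFDeriv ℝ 2 (gauss lam x₀) x ![v, w] = gauss lam x₀ x *
      (4 * lam ^ 2 * (inner ℝ (x - x₀) v * inner ℝ (x - x₀) w) - 2 * lam * inner ℝ v w) := by
  have h1 : fderiv ℝ (gauss lam x₀) =
      (fun y => -(2 * lam) * gauss lam x₀ y) • fun y => innerSL ℝ (y - x₀) :=
    funext fun y => (hasFDerivAt_gauss lam x₀ y).fderiv
  have h2 : HasFDerivAt (fun y : F => innerSL ℝ (y - x₀)) (innerSL ℝ : F →L[ℝ] F →L[ℝ] ℝ) x :=
    (innerSL ℝ : F →L[ℝ] F →L[ℝ] ℝ).hasFDerivAt.comp x ((hasFDerivAt_id x).sub_const x₀)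
  have h3 := ((hasFDerivAt_gauss lam x₀ x).const_mul (-(2 * lam))).smul h2
  have hvw : (innerSL ℝ : F →L[ℝ] F →L[ℝ] ℝ) v w = inner ℝ v w := rfl
  rw [iteratedFDeriv_two_apply, h1, h3.fderiv]
  simp only [Matrix.cons_val_zero, Matrix.cons_val_one, add_apply, smul_apply, smul_eq_mul,
    ContinuousLinearMap.smulRight_apply, innerSL_apply_apply, hvw]
  ring

theorem gauss_add (lam : ℝ) (x₀ x z : F) : gauss lam x₀ (x + z) =
    gauss lam x₀ x * Real.exp (-lam * (2 * inner ℝ (x - x₀) z + ‖z‖ ^ 2)) := by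
  rw [gauss, gauss, ← Real.exp_add, show x + z - x₀ = (x - x₀) + z by abel, norm_add_sq_real]
  congr 1
  ring

end Gauss

theorem neg_jumpEnvelope_le_jumpIntegrand_gauss (lam : ℝ) (x₀ x z : Rd d) (i : Fin m) :
    -jumpEnvelope (lam * gauss lam x₀ x) (gauss lam x₀ x) z ≤
      Coeffs.jumpIntegrand (fun y (_ : Fin m) => gauss lam x₀ y) x i z := by
  unfold Coeffs.jumpIntegrand jumpEnvelope
  have hpos := gauss_pos lam x₀ x
  split_ifs with hz
  · change _ ≤ gauss lam x₀ (x + z) - gauss lam x₀ x - fderiv ℝ (gauss lam x₀) x z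
    rw [fderiv_gauss_apply, gauss_add]
    have := mul_le_mul_of_nonneg_left
      (Real.add_one_le_exp (-lam * (2 * inner ℝ (x - x₀) z + ‖z‖ ^ 2))) hpos.le
    linarith
  · linarith [gauss_pos lam x₀ (x + z)]

theorem gen_gauss {c : Coeffs d m} (hc : c.Standing) (lam : ℝ) (x₀ x : Rd d) (i : Fin m) :
    c.gen (fun y _ => gauss lam x₀ y) x i = gauss lam x₀ x *
        (2 * lam ^ 2 * (∑ k, ∑ l, (x - x₀) k * c.a x i k l * (x - x₀) l)
          - lam * (∑ k, c.a x i k k) - 2 * lam * ∑ k, c.b x i k * (x - x₀) k)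
      + ∫ z, Coeffs.jumpIntegrand (fun y (_ : Fin m) => gauss lam x₀ y) x i z
          ∂(c.jumpMeasure x i) := by
  have hq : ∑ j, c.q x i j * gauss lam x₀ x = 0 := by
    rw [← Finset.sum_mul, hc.q_rowsum, zero_mul]
  have h2 : ∑ k, ∑ l, c.a x i k l * iteratedFDeriv ℝ 2 (gauss lam x₀) x
        ![EuclideanSpace.single k (1 : ℝ), EuclideanSpace.single l (1 : ℝ)] =
      gauss lam x₀ x * (4 * lam ^ 2 * (∑ k, ∑ l, (x - x₀) k * c.a x i k l * (x - x₀) l)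
        - 2 * lam * ∑ k, c.a x i k k) := by
    have : ∀ k l, c.a x i k l * iteratedFDeriv ℝ 2 (gauss lam x₀) x
        ![EuclideanSpace.single k (1 : ℝ), EuclideanSpace.single l (1 : ℝ)] =
        gauss lam x₀ x * (4 * lam ^ 2) * ((x - x₀) k * c.a x i k l * (x - x₀) l) -
          if k = l then gauss lam x₀ x * (2 * lam) * c.a x i k l else 0 := by
      intro k l
      rw [iteratedFDeriv_two_gauss]
      simp only [EuclideanSpace.inner_single_right, PiLp.single_apply]
      split_ifs with h1 h2 h2
      · simp; ring
      · exact absurd h1.symm h2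
      · exact absurd h2.symm h1
      · simp; ring
    simp only [this, Finset.sum_sub_distrib, ← Finset.mul_sum, Finset.sum_ite_eq,
      Finset.mem_univ, if_true]
    ring
  have h1 : ∑ k, c.b x i k * fderiv ℝ (gauss lam x₀) x (EuclideanSpace.single k (1 : ℝ)) =
      gauss lam x₀ x * (-(2 * lam) * ∑ k, c.b x i k * (x - x₀) k) := by
    rw [Finset.mul_sum, Finset.mul_sum]
    refine Finset.sum_congr rfl fun k _ => ?_
    rw [fderiv_gauss_apply, EuclideanSpace.inner_single_right]
    simp
    ring
  change _ * (∑ k, ∑ l, c.a x i k l * iteratedFDeriv ℝ 2 (gauss lam x₀) x _) +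
    (∑ k, c.b x i k * fderiv ℝ (gauss lam x₀) x _) + _ + _ = _
  rw [h2, h1, hq]
  ring

theorem trace_a_le {c : Coeffs d m} (x : Rd d) (i : Fin m) :
    ∑ k, c.a x i k k ≤ (∑ k, ∑ l, |c.sig x i k l|) ^ 2 := by
  have h : ∀ k, c.a x i k k ≤ (∑ l, |c.sig x i k l|) ^ 2 := fun k => by
    have : c.a x i k k = ∑ l, |c.sig x i k l| ^ 2 := by
      simp [Coeffs.a, Matrix.mul_apply, sq]
    rw [this]
    exact Finset.sum_sq_le_sq_sum_of_nonneg fun l _ => abs_nonneg _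
  refine (Finset.sum_le_sum fun k _ => h k).trans ?_
  exact Finset.sum_sq_le_sq_sum_of_nonneg fun k _ => Finset.sum_nonneg fun l _ => abs_nonneg _

theorem sum_mul_le_sum_abs_mul_norm (b y : Rd d) :
    ∑ k, b k * y k ≤ (∑ k, |b k|) * ‖y‖ := by
  rw [Finset.sum_mul]
  refine Finset.sum_le_sum fun k _ => (le_abs_self _).trans ?_
  rw [abs_mul]
  gcongr
  simpa using PiLp.norm_apply_le y k

/-- Lower bound for the generator on Gaussian functions, with the quadratic form of the diffusion
matrix as the main term. -/
theorem exists_le_gen_gauss {c : Coeffs d m} (hc : c.Standing) (x₀ : Rd d) :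
    ∃ C > (0 : ℝ), ∀ lam ≥ (1 : ℝ), ∀ x i,
      gauss lam x₀ x * (2 * lam ^ 2 * (∑ k, ∑ l, (x - x₀) k * c.a x i k l * (x - x₀) l)
        - lam * (C * (1 + ‖x - x₀‖ ^ 2))) ≤ c.gen (fun y _ => gauss lam x₀ y) x i := by
  obtain ⟨J, hJ, hjump⟩ := exists_jump_constant hc
  obtain ⟨C, hC, hgrowth⟩ := hc.growth
  refine ⟨(C ^ 2 + 2 * C + 2 * J) * (2 * (1 + ‖x₀‖) ^ 2), by positivity, fun lam hl x i => ?_⟩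
  have hg := gauss_pos lam x₀ x
  have hl0 : 0 < lam := by linarith
  have hint : -(J * (lam * gauss lam x₀ x * (1 + ‖x‖ ^ 2) + gauss lam x₀ x)) ≤
      ∫ z, Coeffs.jumpIntegrand (fun y (_ : Fin m) => gauss lam x₀ y) x i z
        ∂(c.jumpMeasure x i) := by
    obtain ⟨h1, h2⟩ := hjump x i (lam * gauss lam x₀ x) (gauss lam x₀ x) (by positivity) hg.le
    have h3 : Integrable (Coeffs.jumpIntegrand (fun y (_ : Fin m) => gauss lam x₀ y) x i)
        (c.jumpMeasure x i) :=
      integrable_jumpIntegrand hc (contDiff_gauss lam x₀) (B := 1) (fun y => by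
        rw [abs_of_pos (gauss_pos _ _ _)]; exact gauss_le_one hl0.le _ _) x
    have h4 := integral_mono h1.neg h3
      (fun z => neg_jumpEnvelope_le_jumpIntegrand_gauss lam x₀ x z i)
    rw [integral_neg'] at h4
    linarith
  rw [gen_gauss hc]
  have hsig : 0 ≤ ∑ k, ∑ l, |c.sig x i k l| :=
    Finset.sum_nonneg fun k _ => Finset.sum_nonneg fun l _ => abs_nonneg _
  have hb : 0 ≤ ∑ k, |c.b x i k| := Finset.sum_nonneg fun k _ => abs_nonneg _
  have hgr := hgrowth x i
  have htr : ∑ k, c.a x i k k ≤ C ^ 2 * (1 + ‖x‖) ^ 2 := by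
    refine (trace_a_le x i).trans ?_
    rw [← mul_pow]
    exact pow_le_pow_left₀ hsig (by linarith) 2
  have hdr : ∑ k, c.b x i k * (x - x₀) k ≤ C * (1 + ‖x‖) * ‖x - x₀‖ := by
    refine (sum_mul_le_sum_abs_mul_norm _ _).trans ?_
    gcongr
    linarith
  set y := ‖x - x₀‖ with hy
  set n := ‖x₀‖
  set s := ‖x‖
  have hy0 : 0 ≤ y := norm_nonneg _
  have hn0 : 0 ≤ n := norm_nonneg _
  have hs0 : 0 ≤ s := norm_nonneg _
  have hsle : s ≤ y + n := by
    have := norm_add_le (x - x₀) x₀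
    rwa [sub_add_cancel] at this
  set Q := 2 * (1 + n) ^ 2 * (1 + y ^ 2) with hQ
  have hQ1 : (1 + s) ^ 2 ≤ Q := by
    have h1 : (1 + s) ^ 2 ≤ ((1 + n) + y) ^ 2 := pow_le_pow_left₀ (by positivity) (by linarith) 2
    have h2 : ((1 + n) + y) ^ 2 ≤ 2 * (1 + n) ^ 2 + 2 * y ^ 2 := by
      nlinarith [sq_nonneg ((1 + n) - y)]
    have h3 : 1 ≤ (1 + n) ^ 2 := one_le_pow₀ (by linarith)
    have h4 : y ^ 2 ≤ (1 + n) ^ 2 * y ^ 2 := le_mul_of_one_le_left (by positivity) h3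
    rw [hQ]
    linarith
  have hQ2 : (1 + s) * y ≤ Q := by
    have h3 : 1 ≤ (1 + n) ^ 2 := one_le_pow₀ (by linarith)
    have h4 : y ^ 2 ≤ (1 + n) ^ 2 * y ^ 2 := le_mul_of_one_le_left (by positivity) h3
    have h5 : y ^ 2 ≤ Q := by rw [hQ]; nlinarith
    nlinarith [sq_nonneg ((1 + s) - y)]
  have hQ3 : 2 + s ^ 2 ≤ 2 * Q := by nlinarith
  have e1 : lam * ∑ k, c.a x i k k ≤ lam * (C ^ 2 * Q) := by
    refine mul_le_mul_of_nonneg_left (htr.trans ?_) hl0.le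
    gcongr
  have e2 : 2 * lam * ∑ k, c.b x i k * (x - x₀) k ≤ lam * (2 * C * Q) := by
    have : ∑ k, c.b x i k * (x - x₀) k ≤ C * Q := hdr.trans (by rw [mul_assoc]; gcongr)
    have := mul_le_mul_of_nonneg_left this (show 0 ≤ 2 * lam by positivity)
    linarith
  have e3 : J * (lam * (1 + s ^ 2) + 1) ≤ lam * (2 * J * Q) := by
    have : lam * (1 + s ^ 2) + 1 ≤ lam * (2 * Q) := by
      have := mul_le_mul_of_nonneg_left hQ3 hl0.le
      linarith
    have := mul_le_mul_of_nonneg_left this hJ.le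
    linarith
  have e4 : gauss lam x₀ x * (lam * ∑ k, c.a x i k k + 2 * lam * (∑ k, c.b x i k * (x - x₀) k) +
      J * (lam * (1 + s ^ 2) + 1)) ≤ gauss lam x₀ x * (lam * ((C ^ 2 + 2 * C + 2 * J) * Q)) := by
    refine mul_le_mul_of_nonneg_left ?_ hg.le
    linarith
  rw [hQ] at e4
  linarith

/-! ### Local boundedness of the generator on a Lyapunov function -/

/-- Iterating the comparability of the jump densities along a segment. -/
theorem exists_pit_le_pow_mul_pit {c : Coeffs d m} (hc : c.Standing) :
    ∃ α > (1 : ℝ), ∀ (N : ℕ) (x y w : Rd d) (i : Fin m), ‖x - y‖ ≤ N / 8 →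
      ‖x - y‖ + 1 ≤ ‖w - y‖ → c.pit x i (w - x) ≤ α ^ N * c.pit y i (w - y) := by
  obtain ⟨κ₂, -, β, -, h⟩ := hc.comparability
  obtain ⟨α, hα, -, hcomp⟩ := h (1 / 2) (by norm_num)
  refine ⟨α, hα, fun N => ?_⟩
  induction N with
  | zero =>
    intro x y w i hxy _
    have : x = y := by
      rw [← sub_eq_zero, ← norm_le_zero_iff]
      simpa using hxy
    simp [this]
  | succ N ih =>
    intro x y w i hxy hw
    have hN : (0 : ℝ) < N + 1 := by positivity
    push_cast at hxy
    set x' : Rd d := x + (1 / ((N : ℝ) + 1)) • (y - x) with hx'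
    have h1 : ‖x' - x‖ = ‖x - y‖ / (N + 1) := by
      rw [hx', add_sub_cancel_left, norm_smul, norm_sub_rev y x,
        Real.norm_of_nonneg (by positivity)]
      ring
    have h2 : ‖x' - y‖ = N / (N + 1) * ‖x - y‖ := by
      have : x' - y = ((N : ℝ) / (N + 1)) • (x - y) := by
        have e : (N : ℝ) / (N + 1) = 1 - 1 / (N + 1) := by field_simp; ring
        rw [hx', e, sub_smul, one_smul, smul_sub, smul_sub]
        abel
      rw [this, norm_smul, Real.norm_of_nonneg (by positivity)]
    have h3 : ‖x' - x‖ ≤ 1 / 8 := by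
      rw [h1, div_le_iff₀ hN]; linarith
    have h4 : ‖x' - y‖ ≤ N / 8 := by
      rw [h2]
      calc (N : ℝ) / (N + 1) * ‖x - y‖ ≤ N / (N + 1) * ((N + 1) / 8) := by gcongr
        _ = N / 8 := by field_simp
    have h5 : ‖x' - y‖ ≤ ‖x - y‖ := by
      rw [h2]
      refine mul_le_of_le_one_left (norm_nonneg _) ?_
      rw [div_le_one hN]; linarith
    have h6 := hcomp x x x' w i (by simp) (by rw [mem_ball_iff_norm]; linarith) (by
      rw [mem_ball_iff_norm, not_lt]
      have := norm_sub_le_norm_sub_add_norm_sub w x y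
      linarith)
    have h7 := ih x' y w i h4 (by linarith)
    calc c.pit x i (w - x) ≤ α * c.pit x' i (w - x') := h6
      _ ≤ α * (α ^ N * c.pit y i (w - y)) := by gcongr
      _ = α ^ (N + 1) * c.pit y i (w - y) := by ring

/-- Translated form of an integral against a jump measure. -/
theorem lintegral_jumpMeasure_add {c : Coeffs d m} (hc : c.Standing) {T : Rd d → ℝ≥0∞}
    (hT : Measurable T) (x : Rd d) (i : Fin m) :
    ∫⁻ z, T (x + z) ∂(c.jumpMeasure x i) =
      ∫⁻ w, ENNReal.ofReal (c.pit x i (w - x)) * T w := by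
  have hm : Measurable fun z => ENNReal.ofReal (c.pit x i z) :=
    ((hc.pit_meas i).comp measurable_prodMk_left).ennreal_ofReal
  rw [Coeffs.jumpMeasure, lintegral_withDensity_eq_lintegral_mul _ hm
    (g := fun z => T (x + z)) (hT.comp (measurable_const_add x)),
    ← lintegral_add_left_eq_self (fun w => ENNReal.ofReal (c.pit x i (w - x)) * T w) x]
  simp

/-- If the large jumps from one point integrate `V`, then so do those from all points of a ball,
with a uniform bound. -/
theorem exists_lintegral_far_le {c : Coeffs d m} (hc : c.Standing) {V : Rd d → Fin m → ℝ}
    {i : Fin m} (hV : ContDiff ℝ 2 fun y => V y i) (hV0 : ∀ x, 0 ≤ V x i) {y : Rd d}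
    (hy : Integrable (Coeffs.jumpIntegrand V y i) (c.jumpMeasure y i)) {R : ℝ} (hR : 0 ≤ R) :
    ∃ I : ℝ, 0 ≤ I ∧ ∀ x, ‖x - y‖ ≤ R →
      ∫⁻ z, ENNReal.ofReal (if R + 1 ≤ ‖x + z - y‖ then V (x + z) i else 0)
        ∂(c.jumpMeasure x i) ≤ ENNReal.ofReal I := by
  obtain ⟨α, hα, hpit⟩ := exists_pit_le_pow_mul_pit hc
  obtain ⟨N, hN⟩ := exists_nat_ge (8 * R)
  obtain ⟨J, -, hJ⟩ := exists_jump_constant hc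
  let T : Rd d → ℝ≥0∞ := fun w => ENNReal.ofReal (if R + 1 ≤ ‖w - y‖ then V w i else 0)
  have hT : Measurable T := by
    refine (Measurable.ite (measurableSet_le measurable_const ?_)
      hV.continuous.measurable measurable_const).ennreal_ofReal
    fun_prop
  have hfin : ∫⁻ z, T (y + z) ∂(c.jumpMeasure y i) < ⊤ := by
    have hb := hy.norm.add (hJ y i 0 (V y i) le_rfl (hV0 y)).1
    refine lt_of_le_of_lt (lintegral_mono fun z => ?_) hb.lintegral_lt_top
    refine ENNReal.ofReal_le_ofReal ?_
    simp only [add_sub_cancel_left, Pi.add_apply, Real.norm_eq_abs]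
    have h0 := abs_nonneg (Coeffs.jumpIntegrand V y i z)
    split_ifs with hz
    · have hz1 : ¬ ‖z‖ < 1 := by linarith
      have := le_abs_self (Coeffs.jumpIntegrand V y i z)
      simp only [Coeffs.jumpIntegrand, jumpEnvelope, if_neg hz1] at this ⊢
      linarith
    · exact add_nonneg h0 (jumpEnvelope_nonneg le_rfl (hV0 y) z)
  refine ⟨(ENNReal.ofReal (α ^ N) * ∫⁻ z, T (y + z) ∂(c.jumpMeasure y i)).toReal,
    ENNReal.toReal_nonneg, fun x hx => ?_⟩
  rw [ENNReal.ofReal_toReal (ENNReal.mul_lt_top ENNReal.ofReal_lt_top hfin).ne]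
  change ∫⁻ z, T (x + z) ∂(c.jumpMeasure x i) ≤ _
  rw [lintegral_jumpMeasure_add hc hT, lintegral_jumpMeasure_add hc hT,
    ← lintegral_const_mul' _ _ ENNReal.ofReal_ne_top]
  refine lintegral_mono fun w => ?_
  by_cases hw : R + 1 ≤ ‖w - y‖
  · dsimp only
    rw [← mul_assoc, ← ENNReal.ofReal_mul (pow_nonneg (by linarith) N)]
    refine mul_le_mul_left (ENNReal.ofReal_le_ofReal ?_) _
    exact hpit N x y w i (by linarith) (by linarith)
  · simp [T, hw]

theorem exists_jump_le_of_integrable {c : Coeffs d m} (hc : c.Standing) {V : Rd d → Fin m → ℝ}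
    {i : Fin m} (hV : ContDiff ℝ 2 fun y => V y i) (hV0 : ∀ x, 0 ≤ V x i) {y : Rd d}
    (hy : Integrable (Coeffs.jumpIntegrand V y i) (c.jumpMeasure y i)) {R : ℝ} (hR : 0 ≤ R) :
    ∃ C : ℝ, ∀ x, ‖x - y‖ ≤ R →
      Integrable (Coeffs.jumpIntegrand V x i) (c.jumpMeasure x i) ∧
      ∫ z, Coeffs.jumpIntegrand V x i z ∂(c.jumpMeasure x i) ≤ C := by
  obtain ⟨I, hI0, hI⟩ := exists_lintegral_far_le hc hV hV0 hy hR
  obtain ⟨J, hJ0, hJ⟩ := exists_jump_constant hc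
  obtain ⟨K, hK0, hK⟩ := exists_norm_fderiv_fderiv_le hV y (R + 1)
  obtain ⟨B, hB⟩ := (isCompact_closedBall y (R + 1)).bddAbove_image hV.continuous.continuousOn
  have hB' : ∀ w, ‖w - y‖ ≤ R + 1 → V w i ≤ B := fun w hw =>
    hB (mem_image_of_mem _ (mem_closedBall_iff_norm.2 hw))
  have hB0 : 0 ≤ B := (hV0 y).trans (hB' y (by simp; linarith))
  refine ⟨J * (K * (1 + (R + ‖y‖) ^ 2) + 2 * B) + I, fun x hx => ?_⟩
  let T : Rd d → ℝ := fun z => if R + 1 ≤ ‖x + z - y‖ then V (x + z) i else 0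
  have hT0 : ∀ z, 0 ≤ T z := fun z => by
    simp only [T]; split_ifs
    · exact hV0 _
    · exact le_rfl
  have hTm : Measurable T := by
    refine Measurable.ite (measurableSet_le measurable_const ?_)
      (hV.continuous.comp (continuous_const.add continuous_id)).measurable measurable_const
    fun_prop
  have hTi : Integrable T (c.jumpMeasure x i) := by
    refine ⟨hTm.aestronglyMeasurable, ?_⟩
    rw [hasFiniteIntegral_iff_ofReal (Eventually.of_forall hT0)]
    exact (hI x hx).trans_lt ENNReal.ofReal_lt_top
  have hTI : ∫ z, T z ∂(c.jumpMeasure x i) ≤ I := by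
    rw [integral_eq_lintegral_of_nonneg_ae (Eventually.of_forall hT0) hTm.aestronglyMeasurable]
    exact ENNReal.toReal_le_of_le_ofReal hI0 (hI x hx)
  obtain ⟨hEi, hE⟩ := hJ x i K (2 * B) hK0 (by positivity)
  have hbound : ∀ z, |Coeffs.jumpIntegrand V x i z| ≤ jumpEnvelope K (2 * B) z + T z := by
    intro z
    unfold Coeffs.jumpIntegrand jumpEnvelope
    split_ifs with hz
    · refine (abs_taylor_le hV (convex_closedBall y (R + 1)) hK ?_ ?_).trans
        (le_add_of_nonneg_right (hT0 z))
      · rw [mem_closedBall_iff_norm]; linarith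
      · rw [mem_closedBall_iff_norm, show x + z - y = (x - y) + z by abel]
        exact (norm_add_le _ _).trans (by linarith)
    · have hxB := hB' x (by linarith)
      have hx0 := hV0 x
      have hxz0 := hV0 (x + z)
      rw [sub_zero]
      by_cases hfar : R + 1 ≤ ‖x + z - y‖
      · simp only [T, if_pos hfar]
        rw [abs_le]
        constructor <;> linarith
      · simp only [T, if_neg hfar]
        have := hB' (x + z) (not_le.1 hfar).le
        rw [abs_le]
        constructor <;> linarith
  have hint : Integrable (Coeffs.jumpIntegrand V x i) (c.jumpMeasure x i) :=
    (hEi.add hTi).mono' (measurable_jumpIntegrand hV x).aestronglyMeasurable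
      (Eventually.of_forall hbound)
  refine ⟨hint, ?_⟩
  have h1 := integral_mono hint (hEi.add hTi) fun z => (le_abs_self _).trans (hbound z)
  rw [integral_add' hEi hTi] at h1
  have hxn : ‖x‖ ≤ R + ‖y‖ := by
    have := norm_add_le (x - y) y
    rw [sub_add_cancel] at this
    linarith
  have h2 : J * (K * (1 + ‖x‖ ^ 2) + 2 * B) ≤ J * (K * (1 + (R + ‖y‖) ^ 2) + 2 * B) := by
    gcongr
  linarith

/-- If the jump parts of `GV` converge at one point, then `GV` is bounded above on bounded sets. -/
theorem exists_gen_le_of_integrable {c : Coeffs d m} (hc : c.Standing) {V : Rd d → Fin m → ℝ}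
    (hV : ∀ i, ContDiff ℝ 2 fun y => V y i) (hV0 : ∀ x i, 0 ≤ V x i) {y : Rd d}
    (hy : ∀ i, Integrable (Coeffs.jumpIntegrand V y i) (c.jumpMeasure y i))
    {D : Set (Rd d)} (hD : Bornology.IsBounded D) :
    ∃ C : ℝ, ∀ x ∈ D, ∀ i, Integrable (Coeffs.jumpIntegrand V x i) (c.jumpMeasure x i) ∧
      c.gen V x i ≤ C := by
  obtain ⟨R, hR0, hR⟩ : ∃ R : ℝ, 0 ≤ R ∧ D ⊆ Metric.closedBall y R := by
    obtain ⟨R, hR⟩ := hD.subset_closedBall y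
    exact ⟨max R 0, le_max_right _ _, hR.trans (Metric.closedBall_subset_closedBall
      (le_max_left _ _))⟩
  suffices h : ∀ i, ∃ C : ℝ, ∀ x ∈ Metric.closedBall y R,
      Integrable (Coeffs.jumpIntegrand V x i) (c.jumpMeasure x i) ∧ c.gen V x i ≤ C by
    choose C hC using h
    obtain ⟨M, hM⟩ := (Set.finite_range C).bddAbove
    exact ⟨M, fun x hx i => ⟨(hC i x (hR hx)).1,
      (hC i x (hR hx)).2.trans (hM (mem_range_self i))⟩⟩
  intro i
  obtain ⟨J, hJ⟩ := exists_jump_le_of_integrable hc (hV i) (fun x => hV0 x i) (hy i) hR0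
  have hloc : Continuous fun x => (1 / 2) * ∑ k, ∑ l, c.a x i k l *
      iteratedFDeriv ℝ 2 (fun y => V y i) x
        ![EuclideanSpace.single k (1 : ℝ), EuclideanSpace.single l (1 : ℝ)]
      + ∑ k, c.b x i k * fderiv ℝ (fun y => V y i) x (EuclideanSpace.single k (1 : ℝ)) := by
    refine (continuous_const.mul (continuous_finsetSum _ fun k _ =>
      continuous_finsetSum _ fun l _ => ?_)).add (continuous_finsetSum _ fun k _ => ?_)
    · exact (continuous_a hc i k l).mul (continuous_iteratedFDeriv_two_apply (hV i) _)
    · exact (continuous_b hc i k).mul (continuous_fderiv_apply_const (hV i) _)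
  obtain ⟨L, hL⟩ := (isCompact_closedBall y R).bddAbove_image hloc.continuousOn
  have hq : ∀ j, ∃ C : ℝ, ∀ x ∈ Metric.closedBall y R, c.q x i j * V x j ≤ C := by
    intro j
    obtain ⟨A, hA⟩ := hc.q_bdd i j
    obtain ⟨B, hB⟩ := (isCompact_closedBall y R).bddAbove_image (hV j).continuous.continuousOn
    refine ⟨A * B, fun x hx => ?_⟩
    have hA0 : 0 ≤ A := (abs_nonneg _).trans (hA x)
    calc c.q x i j * V x j ≤ A * V x j :=
          mul_le_mul_of_nonneg_right ((le_abs_self _).trans (hA x)) (hV0 x j)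
      _ ≤ A * B := mul_le_mul_of_nonneg_left (hB (mem_image_of_mem _ hx)) hA0
  choose Q hQ using hq
  refine ⟨L + J + ∑ j, Q j, fun x hx => ?_⟩
  obtain ⟨h1, h2⟩ := hJ x (mem_closedBall_iff_norm.1 hx)
  refine ⟨h1, ?_⟩
  unfold Coeffs.gen
  exact add_le_add (add_le_add (hL (mem_image_of_mem _ hx)) h2)
    (Finset.sum_le_sum fun j _ => hQ j x hx)

/-! ### A Lyapunov function for one regime -/

/-- The function equal to `φ` in the regime `l` and to zero in the other regimes. -/
def inRegime (l : Fin m) (φ : Rd d → ℝ) (y : Rd d) (j : Fin m) : ℝ := if j = l then φ y else 0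

theorem contDiff_inRegime {φ : Rd d → ℝ} (hφ : ContDiff ℝ 2 φ) (l j : Fin m) :
    ContDiff ℝ 2 fun y => inRegime l φ y j := by
  unfold inRegime
  split_ifs
  · exact hφ
  · exact contDiff_const

theorem inRegime_nonneg {φ : Rd d → ℝ} (hφ : ∀ y, 0 ≤ φ y) (l : Fin m) (y : Rd d) (j : Fin m) :
    0 ≤ inRegime l φ y j := by
  unfold inRegime
  split_ifs
  exacts [hφ y, le_rfl]

theorem inRegime_le_one {φ : Rd d → ℝ} (hφ : ∀ y, φ y ≤ 1) (l : Fin m) (y : Rd d) (j : Fin m) :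
    inRegime l φ y j ≤ 1 := by
  unfold inRegime
  split_ifs
  exacts [hφ y, zero_le_one]

theorem gen_inRegime_of_ne (c : Coeffs d m) {l j : Fin m} (hj : j ≠ l) (φ : Rd d → ℝ) (x : Rd d) :
    c.gen (inRegime l φ) x j = c.q x j l * φ x := by
  have h0 : (fun y => inRegime l φ y j) = fun _ => 0 := by
    funext y
    simp [inRegime, hj]
  have h1 : Coeffs.jumpIntegrand (inRegime l φ) x j = 0 := by
    funext z
    simp [Coeffs.jumpIntegrand, inRegime, hj]
  have h2 : iteratedFDeriv ℝ 2 (fun _ : Rd d => (0 : ℝ)) x = 0 := by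
    ext v; simp
  simp only [Coeffs.gen, h0, h1, h2]
  simp [inRegime]

theorem gen_inRegime_nonneg {c : Coeffs d m} (hc : c.Standing) {l j : Fin m} {φ : Rd d → ℝ}
    (hφ : ContDiff ℝ 2 φ) (hφ0 : ∀ y, 0 ≤ φ y) (hφ1 : ∀ y, φ y ≤ 1) {x : Rd d}
    (hx : j ≠ l ∨ φ =ᶠ[𝓝 x] 0) : 0 ≤ c.gen (inRegime l φ) x j := by
  by_cases hj : j = l
  · have hx' : φ =ᶠ[𝓝 x] 0 := hx.resolve_left (not_not.2 hj)
    rw [← gen_const hc 0 x j]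
    refine gen_le_gen_of_eventuallyEq ?_ ?_ (fun y => inRegime_nonneg hφ0 l y j) fun k => ?_
    · rw [jumpIntegrand_const]
      exact integrable_zero _ _ _
    · exact integrable_jumpIntegrand hc (contDiff_inRegime hφ l j) (B := 1) (fun y => by
        rw [abs_of_nonneg (inRegime_nonneg hφ0 l y j)]; exact inRegime_le_one hφ1 l y j) x
    · filter_upwards [hx'] with y hy
      simp [inRegime, hy]
  · rw [gen_inRegime_of_ne c hj]
    exact mul_nonneg (hc.q_nonneg x j l hj) (hφ0 x)

theorem bddDomain_ball (x : Rd d) {r : ℝ} (hr : 0 < r) : BddDomain (Metric.ball x r) :=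
  ⟨Metric.isOpen_ball, (convex_ball x r).isConnected ⟨x, Metric.mem_ball_self hr⟩,
    Metric.isBounded_ball⟩

theorem quadratic_form_nonneg {c : Coeffs d m} (hc : c.Standing) (x ξ : Rd d) (i : Fin m) :
    0 ≤ ∑ k, ∑ l, ξ k * c.a x i k l * ξ l := by
  obtain ⟨κ, hκ, h⟩ := hc.ellipticity _ (bddDomain_ball x one_pos)
  have := (h x (Metric.mem_ball_self one_pos) i ξ).1
  have hκ0 := hκ.1.le
  exact le_trans (by positivity) this

theorem one_add_mul_exp_neg_le {a lam s : ℝ} (ha : 0 ≤ a) (hl : 1 ≤ lam) (hs : a + 1 ≤ s) :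
    (1 + s) * Real.exp (-lam * (s - a)) ≤ (2 + a) / lam := by
  have hl0 : 0 < lam := by linarith
  set u := s - a with hu
  have hu1 : 1 ≤ u := by linarith
  have h1 : u * lam ≤ Real.exp (lam * u) := by
    have e : Real.exp (lam * u) = Real.exp u * Real.exp ((lam - 1) * u) := by
      rw [← Real.exp_add]; congr 1; ring
    have h2 : u ≤ Real.exp u := by linarith [Real.add_one_le_exp u]
    have h3 : lam ≤ Real.exp ((lam - 1) * u) := by
      have := Real.add_one_le_exp ((lam - 1) * u)
      nlinarith
    rw [e]
    exact mul_le_mul h2 h3 hl0.le (Real.exp_pos _).le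
  have h4 : 1 + s ≤ (2 + a) * u := by nlinarith
  rw [neg_mul, Real.exp_neg, ← div_eq_mul_inv, div_le_div_iff₀ (Real.exp_pos _) hl0]
  calc (1 + s) * lam ≤ (2 + a) * u * lam := by gcongr
    _ = (2 + a) * (u * lam) := by ring
    _ ≤ (2 + a) * Real.exp (lam * u) := by gcongr

/-- The Gaussian functions `exp(-λ|x - x₀|²)` with large `λ`: the generator is bounded below on
`r ≤ |x - x₀| ≤ R`, and its negative part further away is negligible in comparison. -/
theorem exists_gauss_barrier {c : Coeffs d m} (hc : c.Standing) (x₀ : Rd d) {r R C : ℝ}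
    (hr : 0 < r) (hR : 0 ≤ R) (hC : 0 < C) :
    ∃ lam ≥ (1 : ℝ), ∃ K > (0 : ℝ), ∃ B : ℝ, ∀ x i,
      (‖x - x₀‖ < r → -B ≤ K * c.gen (fun y _ => gauss lam x₀ y) x i) ∧
      (r ≤ ‖x - x₀‖ → ‖x - x₀‖ ≤ R → C ≤ K * c.gen (fun y _ => gauss lam x₀ y) x i) ∧
      (r ≤ ‖x - x₀‖ → -(1 / 2) ≤ K * c.gen (fun y _ => gauss lam x₀ y) x i) := by
  obtain ⟨C₁, hC₁, hgauss⟩ := exists_le_gen_gauss hc x₀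
  obtain ⟨κ, hκ, hell⟩ := hc.ellipticity _ (bddDomain_ball x₀ (show 0 < R + 2 by linarith))
  have hκ0 : 0 < κ := hκ.1
  obtain ⟨lam, hl1, hl2, hl3⟩ : ∃ lam : ℝ, 1 ≤ lam ∧ C₁ * (2 + R ^ 2) + 1 ≤ lam * (2 * κ * r ^ 2) ∧
      C * C₁ * (2 + R ^ 2) * 2 ≤ lam := by
    have h : ∀ᶠ lam : ℝ in atTop, C₁ * (2 + R ^ 2) + 1 ≤ lam * (2 * κ * r ^ 2) :=
      (tendsto_id.atTop_mul_const (show 0 < 2 * κ * r ^ 2 by positivity)).eventually_ge_atTop _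
    exact ((eventually_ge_atTop 1).and (h.and (eventually_ge_atTop _))).exists
  have hl0 : 0 < lam := by linarith
  set Δ : ℝ := lam * Real.exp (-lam * R ^ 2) with hΔ
  have hΔ0 : 0 < Δ := by positivity
  have hK : C / Δ * Δ = C := div_mul_cancel₀ C hΔ0.ne'
  have hK0 : 0 < C / Δ := by positivity
  have hnear : ∀ x i, r ≤ ‖x - x₀‖ → ‖x - x₀‖ ^ 2 ≤ R ^ 2 + 1 →
      gauss lam x₀ x * lam ≤ c.gen (fun y _ => gauss lam x₀ y) x i := by
    intro x i hrx hRx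
    refine le_trans (mul_le_mul_of_nonneg_left ?_ (gauss_pos lam x₀ x).le) (hgauss lam hl1 x i)
    have hball : x ∈ Metric.ball x₀ (R + 2) := by
      rw [mem_ball_iff_norm]
      by_contra h
      nlinarith [norm_nonneg (x - x₀)]
    have h1 := (hell x hball i (x - x₀)).1
    have h2 : r ^ 2 ≤ ‖x - x₀‖ ^ 2 := pow_le_pow_left₀ hr.le hrx 2
    have h3 : κ * r ^ 2 ≤ ∑ k, ∑ l, (x - x₀) k * c.a x i k l * (x - x₀) l :=
      (mul_le_mul_of_nonneg_left h2 hκ0.le).trans h1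
    have h4 : C₁ * (1 + ‖x - x₀‖ ^ 2) ≤ C₁ * (2 + R ^ 2) :=
      mul_le_mul_of_nonneg_left (by linarith) hC₁.le
    have h5 : lam * 1 ≤ lam * (2 * lam * (∑ k, ∑ l, (x - x₀) k * c.a x i k l * (x - x₀) l)
        - C₁ * (1 + ‖x - x₀‖ ^ 2)) := by
      refine mul_le_mul_of_nonneg_left ?_ hl0.le
      have := mul_le_mul_of_nonneg_left h3 (show 0 ≤ 2 * lam by positivity)
      linarith
    linarith
  have hglobal : ∀ x i, -(gauss lam x₀ x * (lam * (C₁ * (1 + ‖x - x₀‖ ^ 2)))) ≤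
      c.gen (fun y _ => gauss lam x₀ y) x i := by
    intro x i
    refine le_trans ?_ (hgauss lam hl1 x i)
    have := mul_nonneg (gauss_pos lam x₀ x).le (mul_nonneg (show 0 ≤ 2 * lam ^ 2 by positivity)
      (quadratic_form_nonneg hc x (x - x₀) i))
    linarith
  refine ⟨lam, hl1, C / Δ, hK0, C / Δ * (lam * (C₁ * (1 + r ^ 2))), fun x i => ⟨?_, ?_, ?_⟩⟩
  · intro hx
    rw [← mul_neg]
    refine mul_le_mul_of_nonneg_left (le_trans (neg_le_neg ?_) (hglobal x i)) hK0.le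
    have h1 : lam * (C₁ * (1 + ‖x - x₀‖ ^ 2)) ≤ lam * (C₁ * (1 + r ^ 2)) := by gcongr
    exact (mul_le_of_le_one_left (by positivity) (gauss_le_one hl0.le x₀ x)).trans h1
  · intro hrx hRx
    have hsq : ‖x - x₀‖ ^ 2 ≤ R ^ 2 := pow_le_pow_left₀ (norm_nonneg _) hRx 2
    have h1 : Δ ≤ c.gen (fun y _ => gauss lam x₀ y) x i := by
      refine le_trans ?_ (hnear x i hrx (by linarith))
      rw [hΔ, mul_comm]
      refine mul_le_mul_of_nonneg_right (Real.exp_le_exp.2 ?_) hl0.le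
      have := mul_le_mul_of_nonneg_left hsq hl0.le
      linarith
    exact hK.symm.le.trans (mul_le_mul_of_nonneg_left h1 hK0.le)
  · intro hrx
    by_cases hsq : ‖x - x₀‖ ^ 2 ≤ R ^ 2 + 1
    · have h1 : 0 ≤ c.gen (fun y _ => gauss lam x₀ y) x i :=
        le_trans (mul_nonneg (gauss_pos lam x₀ x).le hl0.le) (hnear x i hrx hsq)
      have := mul_nonneg hK0.le h1
      linarith
    · have h1 := mul_le_mul_of_nonneg_left (hglobal x i) hK0.le
      refine le_trans ?_ h1
      have h2 := one_add_mul_exp_neg_le (sq_nonneg R) hl1 (not_le.1 hsq).le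
      have h3 : C / Δ * (gauss lam x₀ x * (lam * (C₁ * (1 + ‖x - x₀‖ ^ 2)))) =
          C * C₁ * ((1 + ‖x - x₀‖ ^ 2) * Real.exp (-lam * (‖x - x₀‖ ^ 2 - R ^ 2))) := by
        have e : Real.exp (-lam * (‖x - x₀‖ ^ 2 - R ^ 2)) =
            gauss lam x₀ x / Real.exp (-lam * R ^ 2) := by
          rw [gauss, ← Real.exp_sub]; congr 1; ring
        rw [e, hΔ]
        field_simp
      have h4 : C * C₁ * ((1 + ‖x - x₀‖ ^ 2) * Real.exp (-lam * (‖x - x₀‖ ^ 2 - R ^ 2))) ≤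
          C * C₁ * ((2 + R ^ 2) / lam) := by gcongr
      have h5 : C * C₁ * ((2 + R ^ 2) / lam) ≤ 1 / 2 := by
        rw [← mul_div_assoc, div_le_iff₀ hl0]
        linarith
      rw [mul_neg, h3]
      linarith

/-- Under (C1) with respect to `D × M` and strict irreducibility on `E`, there is a Lyapunov
function off `E × {l}`. -/
theorem exists_lyapunov {c : Coeffs d m} (hc : c.Standing) (hd : 1 ≤ d) {D : Set (Rd d)}
    (hD : Bornology.IsBounded D) {E : Set (Rd d)} (hE : BddDomain E) (hirr : c.StrictIrred E)
    (l : Fin m) (hC1 : c.C1 D) :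
    ∃ W : Rd d → Fin m → ℝ, (∀ i, ContDiff ℝ 2 fun y => W y i) ∧ (∀ x i, 0 ≤ W x i) ∧
      ∀ p ∉ E ×ˢ ({l} : Set (Fin m)),
        Integrable (Coeffs.jumpIntegrand W p.1 p.2) (c.jumpMeasure p.1 p.2) ∧
        c.gen W p.1 p.2 ≤ -(1 / 2) := by
  obtain ⟨V, hV, hV0, hVD⟩ := hC1
  obtain ⟨y₀, hy₀⟩ : ∃ y, y ∉ D := by
    have : Nonempty (Fin d) := ⟨⟨0, hd⟩⟩
    by_contra! h
    exact NormedSpace.unbounded_univ ℝ (Rd d) (hD.subset fun y _ => h y)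
  obtain ⟨C₀, hC₀⟩ := exists_gen_le_of_integrable hc hV hV0 (fun i => (hVD y₀ hy₀ i).1) hD
  set C : ℝ := max C₀ 0 + 1 with hCdef
  have hC : 0 < C := by positivity
  have hVi : ∀ x i, Integrable (Coeffs.jumpIntegrand V x i) (c.jumpMeasure x i) := fun x i => by
    by_cases hx : x ∈ D
    · exact (hC₀ x hx i).1
    · exact (hVD x hx i).1
  have hVC : ∀ x i, c.gen V x i ≤ C - 1 := fun x i => by
    by_cases hx : x ∈ D
    · have := (hC₀ x hx i).2
      have := le_max_left C₀ 0
      linarith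
    · have := (hVD x hx i).2
      linarith
  obtain ⟨x₀, hx₀⟩ := hE.2.1.nonempty
  obtain ⟨ρ, hρ, hρE⟩ := Metric.nhds_basis_closedBall.mem_iff.1 (hE.1.mem_nhds hx₀)
  obtain ⟨R, hR0, hR⟩ : ∃ R : ℝ, 0 ≤ R ∧ D ⊆ Metric.closedBall x₀ R := by
    obtain ⟨R, hR⟩ := hD.subset_closedBall x₀
    exact ⟨max R 0, le_max_right _ _, hR.trans (Metric.closedBall_subset_closedBall
      (le_max_left _ _))⟩
  let φ : ContDiffBump x₀ := ⟨ρ / 2, ρ, by positivity, by linarith⟩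
  obtain ⟨lam, hl, K, hK, B, hbar⟩ := exists_gauss_barrier hc x₀ (half_pos hρ) hR0 hC
  have hAj : ∀ j, ∃ A : ℝ, 0 ≤ A ∧ (j ≠ l → ∀ x ∈ E, C + B ≤ A * c.q x j l) := by
    intro j
    by_cases hj : j = l
    · exact ⟨0, le_rfl, fun h => absurd hj h⟩
    · obtain ⟨q, hq, hqE⟩ := hirr j l hj
      refine ⟨|C + B| / q, by positivity, fun _ x hx => (le_abs_self _).trans ?_⟩
      calc |C + B| = |C + B| / q * q := (div_mul_cancel₀ _ hq.ne').symm
        _ ≤ |C + B| / q * c.q x j l := by gcongr; exact hqE x hx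
  choose A' hA'0 hA' using hAj
  set A : ℝ := ∑ j, A' j
  have hA0 : 0 ≤ A := Finset.sum_nonneg fun j _ => hA'0 j
  have hA : ∀ j, j ≠ l → ∀ x ∈ E, C + B ≤ A * c.q x j l := fun j hj x hx =>
    (hA' j hj x hx).trans (mul_le_mul_of_nonneg_right
      (Finset.single_le_sum (fun k _ => hA'0 k) (Finset.mem_univ j)) (hc.q_nonneg x j l hj))
  let g : Rd d → Fin m → ℝ := fun y _ => gauss lam x₀ y
  let h : Rd d → Fin m → ℝ := inRegime l φ
  let f₁ : Rd d → Fin m → ℝ := fun y j => V y j + 1 * (fun _ _ => K + A) y j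
  let f₂ : Rd d → Fin m → ℝ := fun y j => f₁ y j + (-K) * g y j
  let W : Rd d → Fin m → ℝ := fun y j => f₂ y j + (-A) * h y j
  have hφ0 : ∀ y, 0 ≤ φ y := fun y => φ.nonneg
  have hφ1 : ∀ y, φ y ≤ 1 := fun y => φ.le_one
  have hg : ∀ j, ContDiff ℝ 2 fun y => g y j := fun _ => contDiff_gauss lam x₀
  have hh : ∀ j, ContDiff ℝ 2 fun y => h y j := contDiff_inRegime (φ.contDiff (n := 2)) l
  have hf₁ : ∀ j, ContDiff ℝ 2 fun y => f₁ y j := fun j =>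
    (hV j).add (contDiff_const.mul contDiff_const)
  have hf₂ : ∀ j, ContDiff ℝ 2 fun y => f₂ y j := fun j =>
    (hf₁ j).add (contDiff_const.mul (hg j))
  have hgi : ∀ x j, Integrable (Coeffs.jumpIntegrand g x j) (c.jumpMeasure x j) := fun x j =>
    integrable_jumpIntegrand hc (hg j) (B := 1) (fun y => by
      rw [abs_of_pos (gauss_pos _ _ _)]; exact gauss_le_one (by linarith) _ _) x
  have hhi : ∀ x j, Integrable (Coeffs.jumpIntegrand h x j) (c.jumpMeasure x j) := fun x j =>
    integrable_jumpIntegrand hc (hh j) (B := 1) (fun y => by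
      rw [abs_of_nonneg (inRegime_nonneg hφ0 l y j)]; exact inRegime_le_one hφ1 l y j) x
  have hci : ∀ x j, Integrable (Coeffs.jumpIntegrand (fun _ (_ : Fin m) => K + A) x j)
      (c.jumpMeasure x j) := fun x j => by
    rw [jumpIntegrand_const]; exact integrable_zero _ _ _
  have hf₁i : ∀ x j, Integrable (Coeffs.jumpIntegrand f₁ x j) (c.jumpMeasure x j) := fun x j =>
    integrable_jumpIntegrand_add_const_mul (hV j) contDiff_const 1 (hVi x j) (hci x j)
  have hf₂i : ∀ x j, Integrable (Coeffs.jumpIntegrand f₂ x j) (c.jumpMeasure x j) := fun x j =>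
    integrable_jumpIntegrand_add_const_mul (hf₁ j) (hg j) (-K) (hf₁i x j) (hgi x j)
  have hgen : ∀ x j, c.gen W x j = c.gen V x j - K * c.gen g x j - A * c.gen h x j := by
    intro x j
    rw [gen_add_const_mul c (hf₂ j) (hh j) (-A) (hf₂i x j) (hhi x j),
      gen_add_const_mul c (hf₁ j) (hg j) (-K) (hf₁i x j) (hgi x j),
      gen_add_const_mul c (hV j) contDiff_const 1 (hVi x j) (hci x j), gen_const hc]
    ring
  refine ⟨W, fun j => (hf₂ j).add (contDiff_const.mul (hh j)), fun y j => ?_, ?_⟩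
  · have h1 := mul_le_mul_of_nonneg_left (gauss_le_one (show 0 ≤ lam by linarith) x₀ y) hK.le
    have h2 := mul_le_mul_of_nonneg_left (inRegime_le_one hφ1 l y j) hA0
    have h3 := hV0 y j
    change 0 ≤ V y j + 1 * (K + A) + (-K) * gauss lam x₀ y + (-A) * inRegime l φ y j
    linarith
  · rintro ⟨x, j⟩ hp
    dsimp only
    refine ⟨integrable_jumpIntegrand_add_const_mul (hf₂ j) (hh j) (-A) (hf₂i x j) (hhi x j), ?_⟩
    rw [hgen]
    obtain ⟨hnear, hmid, hfar⟩ := hbar x j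
    by_cases hx : ‖x - x₀‖ < ρ / 2
    · have hxE : x ∈ E := hρE (mem_closedBall_iff_norm.2 (by linarith))
      have hj : j ≠ l := fun hj => hp ⟨hxE, hj⟩
      have h1 : c.gen h x j = c.q x j l * φ x := gen_inRegime_of_ne c hj φ x
      have h2 : φ x = 1 := φ.one_of_mem_closedBall (mem_closedBall_iff_norm.2 hx.le)
      rw [h1, h2, mul_one]
      have := hnear hx
      have := hA j hj x hxE
      have := hVC x j
      linarith
    · have hx' := not_lt.1 hx
      have h1 : 0 ≤ c.gen h x j := by
        refine gen_inRegime_nonneg hc (φ.contDiff (n := 2)) hφ0 hφ1 ?_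
        by_cases hj : j = l
        · right
          have hxE : x ∉ E := fun hxE => hp ⟨hxE, hj⟩
          refine notMem_tsupport_iff_eventuallyEq.1 ?_
          rw [φ.tsupport_eq]
          exact fun hx => hxE (hρE hx)
        · exact Or.inl hj
      have h2 := mul_nonneg hA0 h1
      by_cases hxD : x ∈ D
      · have := hmid hx' (mem_closedBall_iff_norm.1 (hR hxD))
        have := hVC x j
        linarith
      · have := hfar hx'
        have := (hVD x hxD j).2
        linarith

end

end SJD

theorem positive_recurrence_equivalences {d m : ℕ} (hd : 1 ≤ d) (hm : 1 ≤ m)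
    (c : SJD.Coeffs d m) (hc : c.Standing)
    (P : Kernel (SJD.Rd d × Fin m) (SJD.CadlagPath d m)) (hP : SJD.IsProcess c P)
    (hirr : ∀ B : Set (SJD.Rd d), SJD.BddDomain B → c.StrictIrred B)
    (D : Set (SJD.Rd d)) (hD : SJD.BddDomain D)
    (E : Set (SJD.Rd d)) (hE : SJD.BddDomain E) (l : Fin m)
    (hC1 : c.C1 D) :
    (SJD.PosRecurrent P (D ×ˢ (Set.univ : Set (Fin m))) ↔
      SJD.PosRecurrent P (E ×ˢ (Set.univ : Set (Fin m)))) ∧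
    (SJD.PosRecurrent P (E ×ˢ (Set.univ : Set (Fin m))) ↔
      SJD.PosRecurrent P (E ×ˢ ({l} : Set (Fin m)))) := by
  have hDM : SJD.PosRecurrent P (D ×ˢ (Set.univ : Set (Fin m))) := by
    obtain ⟨V, hV, hV0, hVD⟩ := hC1
    have hnot : ∀ p ∉ D ×ˢ (Set.univ : Set (Fin m)), p.1 ∉ D := fun p hp h => hp ⟨h, trivial⟩
    exact SJD.posRecurrent_of_lyapunov hc hP hV hV0 (hD.1.prod isOpen_univ) one_pos
      (fun p hp => (hVD p.1 (hnot p hp) p.2).1) fun p hp => (hVD p.1 (hnot p hp) p.2).2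
  have hEl : SJD.PosRecurrent P (E ×ˢ ({l} : Set (Fin m))) := by
    obtain ⟨W, hW, hW0, hWE⟩ := SJD.exists_lyapunov hc hd hD.2.2 hE (hirr E hE) l hC1
    exact SJD.posRecurrent_of_lyapunov hc hP hW hW0 (hE.1.prod (isOpen_discrete _))
      (by norm_num : (0 : ℝ) < 1 / 2) (fun p hp => (hWE p hp).1) fun p hp => (hWE p hp).2
  have hEM : SJD.PosRecurrent P (E ×ˢ (Set.univ : Set (Fin m))) :=
    SJD.PosRecurrent.mono hP (Set.prod_mono le_rfl (Set.subset_univ _)) hEl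
  exact ⟨iff_of_true hDM hEM, iff_of_true hEM hEl⟩
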